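/- Let F : C ⇄ D : G be a Quillen adjunction and let x, y be any two objects of the collage (C^c+D^f), regarded as a doubly-pointed model diagram. Let I be a doubly-pointed model diagram, let w : a → b be a morphism of W_I, and let J be the doubly-pointed model diagram obtained from I by freely factoring w as an acyclic cofibration followed by an acyclic fibration. Then restriction along the canonical morphism I → J induces a weak homotopy equivalence N(Fun_{**}(J,(C^c+D^f))^W) → N(Fun_{**}(I,(C^c+D^f))^W). -/

import Mathlib

open CategoryTheory CategoryTheory.Limits

universe w v u

namespace Paper

section

open Simplicial

/-- The map constant at vertex `i` of `Δ[1]`. -/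
def constVertex (X : SSet.{w}) (i : Fin 2) : X ⟶ Δ[1] where
  app m := ↾fun _ => ULift.up (SimplexCategory.const m.unop ⦋1⦌ i)
  naturality _ _ _ := by ext _; rfl

/-- Elementary simplicial homotopy between two maps of simplicial sets,
given by a map out of the cylinder `X ⨯ Δ[1]`. -/
def SHomotopy {X Y : SSet.{w}} (f g : X ⟶ Y) : Prop :=
  ∃ H : X ⨯ Δ[1] ⟶ Y,
    prod.lift (𝟙 X) (constVertex X 0) ≫ H = f ∧
    prod.lift (𝟙 X) (constVertex X 1) ≫ H = g

end

/-- The relation of being simplicially homotopic: the equivalence relation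
generated by elementary simplicial homotopies. -/
def Htpy {X Y : SSet.{w}} (f g : X ⟶ Y) : Prop := Relation.EqvGen SHomotopy f g

/-- A map of simplicial sets is a weak homotopy equivalence (in the Kan–Quillen sense)
iff for every Kan complex `K` the induced map on simplicial homotopy classes of maps
into `K` is a bijection. -/
def IsWeakHomotopyEquiv {X Y : SSet.{w}} (f : X ⟶ Y) : Prop :=
  ∀ (K : SSet.{w}), SSet.KanComplex K →
    (∀ g : X ⟶ K, ∃ h : Y ⟶ K, Htpy (f ≫ h) g) ∧
    (∀ h h' : Y ⟶ K, Htpy (f ≫ h) (f ≫ h') → Htpy h h')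

/-- A simplicial set is weakly contractible if its map to the terminal object
is a weak homotopy equivalence. -/
def WeaklyContractible (X : SSet.{w}) : Prop := IsWeakHomotopyEquiv (terminal.from X)

/-- The map on nerves induced by a functor. -/
def nerveMap {C : Type u} {D : Type u} [Category.{v} C] [Category.{v} D] (F : C ⥤ D) :
    nerve C ⟶ nerve D where
  app _ := ↾fun G => G ⋙ F
  naturality _ _ _ := by ext _; rfl



/-- `f` is a retract of `g` in the arrow category. -/
def IsRetractOf {C : Type u} [Category.{v} C] {X Y X' Y' : C} (f : X ⟶ Y) (g : X' ⟶ Y') : Prop :=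
  ∃ (i : X ⟶ X') (r : X' ⟶ X) (j : Y ⟶ Y') (s : Y' ⟶ Y),
    i ≫ r = 𝟙 X ∧ j ≫ s = 𝟙 Y ∧ i ≫ g = f ≫ j ∧ r ≫ f = g ≫ s

/-- A (Quillen) model structure on a category: three wide subcategories of weak
equivalences, cofibrations and fibrations, satisfying the two-out-of-three, retract,
lifting and factorization axioms.  (No functorial factorizations are assumed; a model
category is a finitely bicomplete category equipped with such a structure.) -/
structure ModelStructure (C : Type u) [Category.{v} C] where
  W : MorphismProperty C
  Cof : MorphismProperty C
  Fib : MorphismProperty C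
  W_id : ∀ X : C, W (𝟙 X)
  Cof_id : ∀ X : C, Cof (𝟙 X)
  Fib_id : ∀ X : C, Fib (𝟙 X)
  W_comp : ∀ {X Y Z : C} (f : X ⟶ Y) (g : Y ⟶ Z), W f → W g → W (f ≫ g)
  Cof_comp : ∀ {X Y Z : C} (f : X ⟶ Y) (g : Y ⟶ Z), Cof f → Cof g → Cof (f ≫ g)
  Fib_comp : ∀ {X Y Z : C} (f : X ⟶ Y) (g : Y ⟶ Z), Fib f → Fib g → Fib (f ≫ g)
  W_of_precomp : ∀ {X Y Z : C} (f : X ⟶ Y) (g : Y ⟶ Z), W f → W (f ≫ g) → W g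
  W_of_postcomp : ∀ {X Y Z : C} (f : X ⟶ Y) (g : Y ⟶ Z), W g → W (f ≫ g) → W f
  W_retract : ∀ {X Y X' Y' : C} {f : X ⟶ Y} {g : X' ⟶ Y'}, IsRetractOf f g → W g → W f
  Cof_retract : ∀ {X Y X' Y' : C} {f : X ⟶ Y} {g : X' ⟶ Y'}, IsRetractOf f g → Cof g → Cof f
  Fib_retract : ∀ {X Y X' Y' : C} {f : X ⟶ Y} {g : X' ⟶ Y'}, IsRetractOf f g → Fib g → Fib f
  lifting_acof_fib : ∀ {A B X Y : C} (i : A ⟶ B) (p : X ⟶ Y),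
    Cof i → W i → Fib p → HasLiftingProperty i p
  lifting_cof_afib : ∀ {A B X Y : C} (i : A ⟶ B) (p : X ⟶ Y),
    Cof i → Fib p → W p → HasLiftingProperty i p
  fact_acof_fib : ∀ {X Y : C} (f : X ⟶ Y),
    ∃ (Z : C) (i : X ⟶ Z) (p : Z ⟶ Y), Cof i ∧ W i ∧ Fib p ∧ i ≫ p = f
  fact_cof_afib : ∀ {X Y : C} (f : X ⟶ Y),
    ∃ (Z : C) (i : X ⟶ Z) (p : Z ⟶ Y), Cof i ∧ Fib p ∧ W p ∧ i ≫ p = f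

/-- An object is cofibrant if the map from an initial object is a cofibration. -/
def Cofibrant {C : Type u} [Category.{v} C] [HasInitial C] (M : ModelStructure C) (X : C) :
    Prop := M.Cof (initial.to X)

/-- An object is fibrant if the map to a terminal object is a fibration. -/
def Fibrant {C : Type u} [Category.{v} C] [HasTerminal C] (M : ModelStructure C) (X : C) :
    Prop := M.Fib (terminal.from X)

/-- A category with a wide subcategory of weak equivalences (a relative category
whose weak equivalences form a wide subcategory). -/
structure RelCatStruct (R : Type u) [Category.{v} R] where
  W : MorphismProperty R
  W_id : ∀ X : R, W (𝟙 X)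
  W_comp : ∀ {X Y Z : R} (f : X ⟶ Y) (g : Y ⟶ Z), W f → W g → W (f ≫ g)

/-- The underlying relative category of a model structure. -/
def ModelStructure.relcat {C : Type u} [Category.{v} C] (M : ModelStructure C) :
    RelCatStruct C :=
  ⟨M.W, M.W_id, M.W_comp⟩

/-- A Quillen adjunction between model categories: an adjunction `F ⊣ G` such that
`F` preserves cofibrations and acyclic cofibrations. -/
structure QuillenAdjunction {C : Type u} {D : Type u} [Category.{v} C] [Category.{v} D]
    (MC : ModelStructure C) (MD : ModelStructure D) where
  F : C ⥤ D
  G : D ⥤ C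
  adj : F ⊣ G
  F_cof : ∀ {X Y : C} (f : X ⟶ Y), MC.Cof f → MD.Cof (F.map f)
  F_acof : ∀ {X Y : C} (f : X ⟶ Y), MC.Cof f → MC.W f → MD.W (F.map f)

section Collage

variable {C : Type u} {D : Type u} [Category.{v} C] [Category.{v} D]

/-- The objects of the collage of an adjunction `F ⊣ G` relative to predicates `PC`, `PD`:
the objects of `C` satisfying `PC` together with the objects of `D` satisfying `PD`. -/
def Collage (_ : D ⥤ C) (PC : C → Prop) (PD : D → Prop) : Type u :=
  {x : C // PC x} ⊕ {y : D // PD y}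

/-- Hom-sets of the collage: morphisms of `C` on the left, morphisms of `D` on the right,
bridge morphisms `hom(x,y) = hom_C(x, G(y))` from left to right, and no morphisms from
right to left. -/
def CollageHom (G : D ⥤ C) (PC : C → Prop) (PD : D → Prop) :
    Collage G PC PD → Collage G PC PD → Type v
  | Sum.inl x, Sum.inl x' => x.1 ⟶ x'.1
  | Sum.inl x, Sum.inr y => x.1 ⟶ G.obj y.1
  | Sum.inr y, Sum.inr y' => y.1 ⟶ y'.1
  | Sum.inr _, Sum.inl _ => PEmpty.{v + 1}

instance {G : D ⥤ C} {PC : C → Prop} {PD : D → Prop} : Category (Collage G PC PD) where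
  Hom := CollageHom G PC PD
  id a := match a with
    | Sum.inl x => (𝟙 x.1 : x.1 ⟶ x.1)
    | Sum.inr y => (𝟙 y.1 : y.1 ⟶ y.1)
  comp {a b c} f g := match a, b, c, f, g with
    | Sum.inl _, Sum.inl _, Sum.inl _, f, g => f ≫ g
    | Sum.inl _, Sum.inl _, Sum.inr _, f, g => f ≫ g
    | Sum.inl _, Sum.inr _, Sum.inr _, f, g => f ≫ G.map g
    | Sum.inr _, Sum.inr _, Sum.inr _, f, g => f ≫ g
    | Sum.inl _, Sum.inr _, Sum.inl _, _, g => g.elim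
    | Sum.inr _, Sum.inl _, _, f, _ => f.elim
    | Sum.inr _, Sum.inr _, Sum.inl _, _, g => g.elim
  id_comp {a b} f := by
    rcases a with x|y <;> rcases b with x'|y' <;> first | exact f.elim | exact Category.id_comp _
  comp_id {a b} f := by
    rcases a with x|y <;> rcases b with x'|y' <;>
      first
        | exact f.elim | exact Category.comp_id _
        | (simp [CategoryTheory.Functor.map_id]; exact Category.comp_id _)
  assoc {a b c d} f g h := by
    rcases a with xa|ya <;> rcases b with xb|yb <;> rcases c with xc|yc <;>
      rcases d with xd|yd <;>
      first
        | exact f.elim | exact g.elim | exact h.elim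
        | exact Category.assoc _ _ _
        | exact (Category.assoc (obj := C) (W := xa.1) (X := G.obj yb.1) f (G.map g) (G.map h)).trans
            (congrArg (CategoryStruct.comp (obj := C) (X := xa.1) (Y := G.obj yb.1) f)
              (CategoryTheory.Functor.map_comp G _ _).symm)

/-- The weak equivalences of the collage: those of the two fibers; no bridge morphism is
a weak equivalence. -/
def collW (G : D ⥤ C) (PC : C → Prop) (PD : D → Prop)
    (WC : MorphismProperty C) (WD : MorphismProperty D) :
    MorphismProperty (Collage G PC PD) := fun a b f =>
  match a, b, f with
  | Sum.inl _, Sum.inl _, f => WC f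
  | Sum.inr _, Sum.inr _, f => WD f
  | Sum.inl _, Sum.inr _, _ => False
  | Sum.inr _, Sum.inl _, _ => False

/-- The collage of a Quillen adjunction as a relative category. -/
def collageRel {MC : ModelStructure C} {MD : ModelStructure D}
    (Q : QuillenAdjunction MC MD) (PC : C → Prop) (PD : D → Prop) :
    RelCatStruct (Collage Q.G PC PD) where
  W := collW Q.G PC PD MC.W MD.W
  W_id X := by
    rcases X with x|y
    · exact MC.W_id x.1
    · exact MD.W_id y.1
  W_comp {X Y Z} f g hf hg := by
    rcases X with x|y <;> rcases Y with x'|y' <;> rcases Z with x''|y'' <;>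
      first
        | exact f.elim | exact g.elim | exact hf.elim | exact hg.elim
        | exact MC.W_comp f g hf hg
        | exact MD.W_comp f g hf hg

end Collage

/-- Transporting a component of a natural transformation along an equality of objects. -/
lemma natTrans_app_congr {J E : Type u} [Category.{v} J] [Category.{v} E]
    {F G : J ⥤ E} (η : F ⟶ G) {p q : J} (e : p = q) :
    η.app p = eqToHom (by rw [e]) ≫ η.app q ≫ eqToHom (by rw [e]) := by
  subst e; simp

section ModelDiagrams

/-- A model diagram: a category equipped with three wide subcategories `W`, `C`, `F`
such that `W` satisfies the two-out-of-three axiom. -/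
structure ModelDiag (I : Type u) [Category.{v} I] where
  W : MorphismProperty I
  C : MorphismProperty I
  F : MorphismProperty I
  W_id : ∀ X : I, W (𝟙 X)
  C_id : ∀ X : I, C (𝟙 X)
  F_id : ∀ X : I, F (𝟙 X)
  W_comp : ∀ {X Y Z : I} (f : X ⟶ Y) (g : Y ⟶ Z), W f → W g → W (f ≫ g)
  C_comp : ∀ {X Y Z : I} (f : X ⟶ Y) (g : Y ⟶ Z), C f → C g → C (f ≫ g)
  F_comp : ∀ {X Y Z : I} (f : X ⟶ Y) (g : Y ⟶ Z), F f → F g → F (f ≫ g)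
  W_of_precomp : ∀ {X Y Z : I} (f : X ⟶ Y) (g : Y ⟶ Z), W f → W (f ≫ g) → W g
  W_of_postcomp : ∀ {X Y Z : I} (f : X ⟶ Y) (g : Y ⟶ Z), W g → W (f ≫ g) → W f

/-- A model category is a model diagram via its weak equivalences, cofibrations and
fibrations. -/
def ModelStructure.diag {C : Type u} [Category.{v} C] (M : ModelStructure C) :
    ModelDiag C where
  W := M.W
  C := M.Cof
  F := M.Fib
  W_id := M.W_id
  C_id := M.Cof_id
  F_id := M.Fib_id
  W_comp := M.W_comp
  C_comp := M.Cof_comp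
  F_comp := M.Fib_comp
  W_of_precomp := M.W_of_precomp
  W_of_postcomp := M.W_of_postcomp

variable {I : Type u} {J : Type u} {E : Type u}
  [Category.{v} I] [Category.{v} J] [Category.{v} E]

/-- A morphism of model diagrams: a functor preserving each of the three wide
subcategories. -/
structure MDHom (MI : ModelDiag I) (ME : ModelDiag E) where
  func : I ⥤ E
  map_W : ∀ {X Y : I} (f : X ⟶ Y), MI.W f → ME.W (func.map f)
  map_C : ∀ {X Y : I} (f : X ⟶ Y), MI.C f → ME.C (func.map f)
  map_F : ∀ {X Y : I} (f : X ⟶ Y), MI.F f → ME.F (func.map f)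

/-- Composition of morphisms of model diagrams. -/
def MDHom.comp {MI : ModelDiag I} {MJ : ModelDiag J} {ME : ModelDiag E}
    (α : MDHom MI MJ) (β : MDHom MJ ME) : MDHom MI ME where
  func := α.func ⋙ β.func
  map_W _ hf := β.map_W _ (α.map_W _ hf)
  map_C _ hf := β.map_C _ (α.map_C _ hf)
  map_F _ hf := β.map_F _ (α.map_F _ hf)

/-- The identity morphism of model diagrams. -/
def MDHom.id (MI : ModelDiag I) : MDHom MI MI where
  func := Functor.id I
  map_W _ hf := hf
  map_C _ hf := hf
  map_F _ hf := hf

/-- A morphism of doubly-pointed model diagrams: a morphism of model diagrams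
preserving the two chosen objects. -/
structure PtdMDHom (MI : ModelDiag I) (sI tI : I) (ME : ModelDiag E) (sE tE : E)
    extends MDHom MI ME where
  hs : func.obj sI = sE
  ht : func.obj tI = tE

/-- Composition of morphisms of doubly-pointed model diagrams. -/
def PtdMDHom.comp {MI : ModelDiag I} {sI tI : I} {MJ : ModelDiag J} {sJ tJ : J}
    {ME : ModelDiag E} {sE tE : E} (α : PtdMDHom MI sI tI MJ sJ tJ)
    (β : PtdMDHom MJ sJ tJ ME sE tE) : PtdMDHom MI sI tI ME sE tE where
  toMDHom := α.toMDHom.comp β.toMDHom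
  hs := by
    show β.func.obj (α.func.obj sI) = sE
    rw [α.hs, β.hs]
  ht := by
    show β.func.obj (α.func.obj tI) = tE
    rw [α.ht, β.ht]

/-- The identity as a morphism of doubly-pointed model diagrams. -/
def PtdMDHom.ptdId (MI : ModelDiag I) (sI tI : I) : PtdMDHom MI sI tI MI sI tI where
  toMDHom := MDHom.id MI
  hs := rfl
  ht := rfl

/-- The category `Fun_{**}(I,E)^W`: objects are the morphisms of doubly-pointed model
diagrams `I → E`; morphisms are the natural transformations all of whose components lie
in `W_E` and whose components at `s` and `t` are identities. -/
def FunPt (MI : ModelDiag I) (sI tI : I) (ME : ModelDiag E) (sE tE : E) : Type (max u v) :=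
  PtdMDHom MI sI tI ME sE tE

instance {MI : ModelDiag I} {sI tI : I} {ME : ModelDiag E} {sE tE : E} :
    Category.{max u v} (FunPt MI sI tI ME sE tE) where
  Hom X Y := { η : X.func ⟶ Y.func // (∀ i : I, ME.W (η.app i)) ∧
    η.app sI = eqToHom (X.hs.trans Y.hs.symm) ∧
    η.app tI = eqToHom (X.ht.trans Y.ht.symm) }
  id X := ⟨𝟙 X.func, fun _ => ME.W_id _, by simp, by simp⟩
  comp {X Y Z} η θ := ⟨η.1 ≫ θ.1, fun i => ME.W_comp _ _ (η.2.1 i) (θ.2.1 i),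
    by rw [NatTrans.comp_app, η.2.2.1, θ.2.2.1, eqToHom_trans],
    by rw [NatTrans.comp_app, η.2.2.2, θ.2.2.2, eqToHom_trans]⟩
  id_comp _ := by apply Subtype.ext; simp
  comp_id _ := by apply Subtype.ext; simp
  assoc _ _ _ := by apply Subtype.ext; simp

/-- Restriction `Fun_{**}(J,E)^W ⥤ Fun_{**}(I,E)^W` along a morphism of doubly-pointed
model diagrams `φ : I → J`. -/
def restrict {MI : ModelDiag I} {sI tI : I} {MJ : ModelDiag J} {sJ tJ : J}
    (φ : PtdMDHom MI sI tI MJ sJ tJ) (ME : ModelDiag E) (sE tE : E) :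
    FunPt MJ sJ tJ ME sE tE ⥤ FunPt MI sI tI ME sE tE where
  obj X :=
    { func := φ.func ⋙ X.func
      map_W := fun f hf => X.map_W _ (φ.map_W f hf)
      map_C := fun f hf => X.map_C _ (φ.map_C f hf)
      map_F := fun f hf => X.map_F _ (φ.map_F f hf)
      hs := by show X.func.obj (φ.func.obj sI) = sE; rw [φ.hs, X.hs]
      ht := by show X.func.obj (φ.func.obj tI) = tE; rw [φ.ht, X.ht] }
  map {X Y} η := ⟨CategoryTheory.Functor.whiskerLeft φ.func η.1, fun i => η.2.1 _,
    by
      show η.1.app (φ.func.obj sI) = _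
      rw [natTrans_app_congr η.1 φ.hs, η.2.2.1, eqToHom_trans, eqToHom_trans],
    by
      show η.1.app (φ.func.obj tI) = _
      rw [natTrans_app_congr η.1 φ.ht, η.2.2.2, eqToHom_trans, eqToHom_trans]⟩
  map_id _ := rfl
  map_comp _ _ := rfl

end ModelDiagrams

/-- The collage of a Quillen adjunction as a model diagram: weak equivalences,
cofibrations and fibrations are those of the two fibers; bridge morphisms lie in none of
the three classes. -/
def collageDiag {C : Type u} {D : Type u} [Category.{v} C] [Category.{v} D]
    {MC : ModelStructure C} {MD : ModelStructure D}
    (Q : QuillenAdjunction MC MD) (PC : C → Prop) (PD : D → Prop) :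
    ModelDiag (Collage Q.G PC PD) where
  W := collW Q.G PC PD MC.W MD.W
  C := collW Q.G PC PD MC.Cof MD.Cof
  F := collW Q.G PC PD MC.Fib MD.Fib
  W_id X := by
    rcases X with x|y
    · exact MC.W_id x.1
    · exact MD.W_id y.1
  C_id X := by
    rcases X with x|y
    · exact MC.Cof_id x.1
    · exact MD.Cof_id y.1
  F_id X := by
    rcases X with x|y
    · exact MC.Fib_id x.1
    · exact MD.Fib_id y.1
  W_comp {X Y Z} f g hf hg := by
    rcases X with x|y <;> rcases Y with x'|y' <;> rcases Z with x''|y'' <;>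
      first
        | exact f.elim | exact g.elim | exact hf.elim | exact hg.elim
        | exact MC.W_comp f g hf hg
        | exact MD.W_comp f g hf hg
  C_comp {X Y Z} f g hf hg := by
    rcases X with x|y <;> rcases Y with x'|y' <;> rcases Z with x''|y'' <;>
      first
        | exact f.elim | exact g.elim | exact hf.elim | exact hg.elim
        | exact MC.Cof_comp f g hf hg
        | exact MD.Cof_comp f g hf hg
  F_comp {X Y Z} f g hf hg := by
    rcases X with x|y <;> rcases Y with x'|y' <;> rcases Z with x''|y'' <;>
      first
        | exact f.elim | exact g.elim | exact hf.elim | exact hg.elim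
        | exact MC.Fib_comp f g hf hg
        | exact MD.Fib_comp f g hf hg
  W_of_precomp {X Y Z} f g hf hfg := by
    rcases X with x|y <;> rcases Y with x'|y' <;> rcases Z with x''|y'' <;>
      first
        | exact f.elim | exact g.elim | exact hf.elim | exact hfg.elim
        | exact MC.W_of_precomp f g hf hfg
        | exact MD.W_of_precomp f g hf hfg
  W_of_postcomp {X Y Z} f g hg hfg := by
    rcases X with x|y <;> rcases Y with x'|y' <;> rcases Z with x''|y'' <;>
      first
        | exact f.elim | exact g.elim | exact hg.elim | exact hfg.elim
        | exact MC.W_of_postcomp f g hg hfg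
        | exact MD.W_of_postcomp f g hg hfg

section SimplicialHomotopy

open Simplicial MonoidalCategory CartesianMonoidalCategory HomotopicalAlgebra
open scoped SSet.modelCategoryQuillen

/-- The inclusion of `X` as one of the two ends of the cylinder `X ⊗ Δ[1]`. -/
noncomputable def cyl (X : SSet.{w}) (i : Fin 2) : X ⟶ X ⊗ Δ[1] := lift (𝟙 X) (constVertex X i)

lemma cyl_whiskerRight_assoc {X Y Z : SSet.{w}} (f : X ⟶ Y) (i : Fin 2) (g : Y ⊗ Δ[1] ⟶ Z) :
    cyl X i ≫ f ▷ Δ[1] ≫ g = f ≫ cyl Y i ≫ g := rfl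

lemma cyl_fst {X : SSet.{w}} (i : Fin 2) : cyl X i ≫ fst X Δ[1] = 𝟙 X := rfl

lemma sHomotopy_iff {X Y : SSet.{w}} (f g : X ⟶ Y) :
    SHomotopy f g ↔ ∃ H : X ⊗ Δ[1] ⟶ Y, cyl X 0 ≫ H = f ∧ cyl X 1 ≫ H = g := by
  constructor
  · rintro ⟨H, h₀, h₁⟩
    have key (i : Fin 2) : cyl X i ≫ prod.lift (fst X Δ[1]) (snd X Δ[1]) =
        prod.lift (𝟙 X) (constVertex X i) := by
      ext1 <;> simp [cyl]
    refine ⟨prod.lift (fst X Δ[1]) (snd X Δ[1]) ≫ H, ?_, ?_⟩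
    · rw [← Category.assoc, key, h₀]
    · rw [← Category.assoc, key, h₁]
  · rintro ⟨H, h₀, h₁⟩
    have key (i : Fin 2) : prod.lift (𝟙 X) (constVertex X i) ≫
        lift (Limits.prod.fst : X ⨯ Δ[1] ⟶ X) Limits.prod.snd = cyl X i := by
      ext1
      · simp [cyl, Limits.prod.lift_fst]
      · simp [cyl, Limits.prod.lift_snd]
    refine ⟨lift Limits.prod.fst Limits.prod.snd ≫ H, ?_, ?_⟩
    · rw [← Category.assoc, key, h₀]
    · rw [← Category.assoc, key, h₁]

lemma SHomotopy.of_cyl {X Y : SSet.{w}} (H : X ⊗ Δ[1] ⟶ Y) :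
    SHomotopy (cyl X 0 ≫ H) (cyl X 1 ≫ H) :=
  (sHomotopy_iff _ _).2 ⟨H, rfl, rfl⟩

lemma Htpy.of_cyl {X Y : SSet.{w}} (H : X ⊗ Δ[1] ⟶ Y) :
    Htpy (cyl X 0 ≫ H) (cyl X 1 ≫ H) :=
  .rel _ _ (SHomotopy.of_cyl H)

lemma Htpy.refl {X Y : SSet.{w}} (f : X ⟶ Y) : Htpy f f := Relation.EqvGen.refl _

lemma Htpy.symm {X Y : SSet.{w}} {f g : X ⟶ Y} (h : Htpy f g) : Htpy g f :=
  Relation.EqvGen.symm _ _ h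

lemma Htpy.trans {X Y : SSet.{w}} {f g k : X ⟶ Y} (h : Htpy f g) (h' : Htpy g k) : Htpy f k :=
  Relation.EqvGen.trans _ _ _ h h'

lemma Htpy.precomp {X Y Z : SSet.{w}} (e : X ⟶ Y) {f g : Y ⟶ Z} (h : Htpy f g) :
    Htpy (e ≫ f) (e ≫ g) := by
  induction h with
  | rel f g h =>
    obtain ⟨H, rfl, rfl⟩ := (sHomotopy_iff _ _).1 h
    exact Htpy.of_cyl (e ▷ Δ[1] ≫ H)
  | refl => exact .refl _
  | symm _ _ _ ih => exact ih.symm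
  | trans _ _ _ _ _ ih ih' => exact ih.trans ih'

lemma Htpy.postcomp {X Y Z : SSet.{w}} {f g : X ⟶ Y} (h : Htpy f g) (e : Y ⟶ Z) :
    Htpy (f ≫ e) (g ≫ e) := by
  induction h with
  | rel f g h =>
    obtain ⟨H, rfl, rfl⟩ := (sHomotopy_iff _ _).1 h
    exact Htpy.of_cyl (H ≫ e)
  | refl => exact .refl _
  | symm _ _ _ ih => exact ih.symm
  | trans _ _ _ _ _ ih ih' => exact ih.trans ih'

lemma IsWeakHomotopyEquiv.comp {X Y Z : SSet.{w}} {f : X ⟶ Y} {g : Y ⟶ Z}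
    (hf : IsWeakHomotopyEquiv f) (hg : IsWeakHomotopyEquiv g) : IsWeakHomotopyEquiv (f ≫ g) := by
  intro K hK
  refine ⟨fun k ↦ ?_, fun h h' H ↦ (hg K hK).2 _ _ ((hf K hK).2 _ _ ?_)⟩
  · obtain ⟨l, hl⟩ := (hf K hK).1 k
    obtain ⟨r, hr⟩ := (hg K hK).1 l
    exact ⟨r, by simpa using (hr.precomp f).trans hl⟩
  · simpa using H

lemma IsWeakHomotopyEquiv.of_homotopyInverse {X Y : SSet.{w}} {f : X ⟶ Y} (g : Y ⟶ X)
    (h₁ : Htpy (f ≫ g) (𝟙 X)) (h₂ : Htpy (g ≫ f) (𝟙 Y)) : IsWeakHomotopyEquiv f := by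
  intro K _
  refine ⟨fun k ↦ ⟨g ≫ k, by simpa using h₁.postcomp k⟩, fun h h' H ↦ ?_⟩
  have := H.precomp g
  rw [← Category.assoc, ← Category.assoc] at this
  simpa using ((h₂.postcomp h).symm.trans this).trans (h₂.postcomp h')

lemma fin_two_eq_one_sub : ∀ {a j : Fin 2}, a ≠ j → a = 1 - j := by decide

lemma fin_two_ne_one_sub : ∀ i : Fin 2, i ≠ 1 - i := by decide

/-- Every vertex of the interval is either constantly `0` or constantly `1` on `θ`. -/
lemma eq_const_of_mem_boundary_one {n : SimplexCategoryᵒᵖ} (θ : (Δ[1] : SSet.{w}).obj n)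
    (hθ : θ ∈ (∂Δ[1] : SSet.Subcomplex _).obj n) :
    ∃ i : Fin 2, θ = ULift.up (SimplexCategory.const n.unop ⦋1⦌ i) := by
  have h : ¬ Function.Surjective (SSet.stdSimplex.objEquiv θ).toOrderHom := hθ
  rw [Function.Surjective] at h
  push Not at h
  obtain ⟨j, hj⟩ := h
  refine ⟨1 - j, SSet.stdSimplex.objEquiv.injective ?_⟩
  ext k : 3
  exact fin_two_eq_one_sub (hj k)

lemma eq_const_of_mem_horn_one (i : Fin 2) {n : SimplexCategoryᵒᵖ} (θ : (Δ[1] : SSet.{w}).obj n)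
    (hθ : θ ∈ (Λ[1, i] : SSet.Subcomplex _).obj n) :
    θ = ULift.up (SimplexCategory.const n.unop ⦋1⦌ i) := by
  have h : Set.range (SSet.stdSimplex.asOrderHom θ) ∪ {i} ≠ Set.univ := hθ
  refine SSet.stdSimplex.objEquiv.injective ?_
  ext k : 3
  change (SSet.stdSimplex.asOrderHom θ) k = i
  by_contra hk
  apply h
  ext a
  by_cases ha : a = i
  · simp [ha]
  · simp [(fin_two_eq_one_sub ha).trans (fin_two_eq_one_sub hk).symm]

/-- The map out of `X ⊗ ∂Δ[1]` given by two maps out of `X`. -/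
noncomputable def boundaryDesc {X Y : SSet.{w}} (f : Fin 2 → (X ⟶ Y)) :
    X ⊗ (∂Δ[1] : SSet.{w}) ⟶ Y where
  app n := ↾fun z ↦ (f ((SSet.stdSimplex.objEquiv z.2.1).toOrderHom 0)).app n z.1
  naturality n n' φ := by
    ext ⟨x, θ, hθ⟩
    obtain ⟨i, rfl⟩ := eq_const_of_mem_boundary_one θ hθ
    exact ConcreteCategory.congr_hom ((f i).naturality φ) x

lemma hom_ext_cyl {X Y : SSet.{w}} {f g : X ⊗ (∂Δ[1] : SSet.{w}) ⟶ Y}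
    (h : ∀ (i : Fin 2) n (x : X.obj n) hx,
      f.app n (x, ⟨ULift.up (SimplexCategory.const n.unop ⦋1⦌ i), hx⟩) =
      g.app n (x, ⟨ULift.up (SimplexCategory.const n.unop ⦋1⦌ i), hx⟩)) : f = g := by
  ext n ⟨x, θ, hθ⟩
  obtain ⟨i, rfl⟩ := eq_const_of_mem_boundary_one θ hθ
  exact h i _ _ _

lemma const_mem_boundary_one (i : Fin 2) (n : SimplexCategoryᵒᵖ) :
    ULift.up (SimplexCategory.const n.unop ⦋1⦌ i) ∈ (∂Δ[1] : SSet.Subcomplex.{w} _).obj n := by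
  intro h
  obtain ⟨k, hk⟩ := h (1 - i)
  exact fin_two_ne_one_sub i hk

lemma cyl_eq_of_boundary {X Y : SSet.{w}} (f : Fin 2 → (X ⟶ Y)) (H : X ⊗ Δ[1] ⟶ Y)
    (h : X ◁ (∂Δ[1] : SSet.Subcomplex.{w} _).ι ≫ H = boundaryDesc f) (i : Fin 2) :
    cyl X i ≫ H = f i := by
  ext n x
  let z : (X ⊗ (∂Δ[1] : SSet.{w})).obj n :=
    (x, ⟨ULift.up (SimplexCategory.const n.unop ⦋1⦌ i), const_mem_boundary_one i n⟩)
  exact ConcreteCategory.congr_hom (NatTrans.congr_app h n) z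

lemma pushoutProduct_lift {A B S T E Z : SSet.{w}} (i : A ⟶ B) (j : S ⟶ T)
    [Mono i] [Mono j] (hij : SSet.anodyneExtensions i ∨ SSet.anodyneExtensions j)
    (p : E ⟶ Z) [Fibration p] (H : B ⊗ T ⟶ Z) (k : B ⊗ S ⟶ E) (l : A ⊗ T ⟶ E)
    (hkl : i ▷ S ≫ k = A ◁ j ≫ l) (hk : k ≫ p = B ◁ j ≫ H) (hl : l ≫ p = i ▷ T ≫ H) :
    ∃ L : B ⊗ T ⟶ E, L ≫ p = H ∧ B ◁ j ≫ L = k ∧ i ▷ T ≫ L = l := by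
  let sq := Functor.PushoutObjObj.ofHasPushout (curriedTensor SSet) i j
  have hsq : SSet.anodyneExtensions sq.ι := by
    rcases hij with h | h
    · exact SSet.anodyneExtensions_pushoutObjObjι' sq h
    · exact SSet.anodyneExtensions_pushoutObjObjι sq h
  have := hsq p (mem_fibrations p)
  have comm : sq.isPushout.desc k l hkl ≫ p = sq.ι ≫ H := by
    apply sq.isPushout.hom_ext
    · rw [← Category.assoc, ← Category.assoc, sq.inl_ι, IsPushout.inl_desc]
      exact hk
    · rw [← Category.assoc, ← Category.assoc, sq.inr_ι, IsPushout.inr_desc]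
      exact hl
  have sq' : CommSq (sq.isPushout.desc k l hkl) sq.ι p H := ⟨comm⟩
  refine ⟨sq'.lift, sq'.fac_right, ?_, ?_⟩
  · exact (congrArg (· ≫ sq'.lift) sq.inl_ι.symm).trans ((Category.assoc _ _ _).trans
      ((congrArg (sq.inl ≫ ·) sq'.fac_left).trans (sq.isPushout.inl_desc k l hkl)))
  · exact (congrArg (· ≫ sq'.lift) sq.inr_ι.symm).trans ((Category.assoc _ _ _).trans
      ((congrArg (sq.inr ≫ ·) sq'.fac_left).trans (sq.isPushout.inr_desc k l hkl)))

end SimplicialHomotopy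

section Anodyne

open Simplicial MonoidalCategory CartesianMonoidalCategory HomotopicalAlgebra
open scoped SSet.modelCategoryQuillen

lemma whiskerLeft_horn_comp_fst {B E : SSet.{w}} (ε : Fin 2) (f : B ⟶ E) (H : B ⊗ Δ[1] ⟶ E)
    (hf : f = cyl B ε ≫ H) :
    fst B (Λ[1, ε] : SSet.{w}) ≫ f = B ◁ (Λ[1, ε] : SSet.Subcomplex.{w} _).ι ≫ H := by
  subst hf
  ext n ⟨x, θ, hθ⟩
  obtain rfl := eq_const_of_mem_horn_one ε θ hθ
  rfl

lemma const_mem_horn_one (ε : Fin 2) (n : SimplexCategoryᵒᵖ) :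
    ULift.up (SimplexCategory.const n.unop ⦋1⦌ ε) ∈
      (Λ[1, ε] : SSet.Subcomplex.{w} _).obj n := by
  intro h
  have : (1 - ε) ∈ (Set.univ : Set (Fin 2)) := trivial
  rw [← h] at this
  rcases this with ⟨k, hk⟩ | hk
  · exact fin_two_ne_one_sub ε hk
  · exact fin_two_ne_one_sub ε hk.symm

lemma cyl_comp_eq_of_horn {B E : SSet.{w}} (ε : Fin 2) (f : B ⟶ E) (H : B ⊗ Δ[1] ⟶ E)
    (h : B ◁ (Λ[1, ε] : SSet.Subcomplex.{w} _).ι ≫ H = fst B (Λ[1, ε] : SSet.{w}) ≫ f) :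
    cyl B ε ≫ H = f := by
  ext n x
  let z : (B ⊗ (Λ[1, ε] : SSet.{w})).obj n :=
    (x, ⟨ULift.up (SimplexCategory.const n.unop ⦋1⦌ ε), const_mem_horn_one ε n⟩)
  exact ConcreteCategory.congr_hom (NatTrans.congr_app h n) z

lemma homotopy_lift {A B E Z : SSet.{w}} (i : A ⟶ B) [Mono i] (p : E ⟶ Z) [Fibration p]
    (ε : Fin 2) (H : B ⊗ Δ[1] ⟶ Z) (f : B ⟶ E) (hf : f ≫ p = cyl B ε ≫ H)
    (k : A ⊗ Δ[1] ⟶ E) (hk : k ≫ p = i ▷ Δ[1] ≫ H) (hfk : cyl A ε ≫ k = i ≫ f) :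
    ∃ L : B ⊗ Δ[1] ⟶ E, L ≫ p = H ∧ cyl B ε ≫ L = f ∧ i ▷ Δ[1] ≫ L = k := by
  obtain ⟨L, h₁, h₂, h₃⟩ := pushoutProduct_lift i (Λ[1, ε] : SSet.Subcomplex.{w} _).ι
    (.inr (SSet.anodyneExtensions.horn_ι ε)) p H (fst _ _ ≫ f) k
    (by rw [← whiskerLeft_horn_comp_fst ε _ k hfk.symm]; rfl)
    (by rw [Category.assoc, whiskerLeft_horn_comp_fst ε _ H hf]) hk
  exact ⟨L, h₁, cyl_comp_eq_of_horn _ _ _ h₂, h₃⟩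

lemma homotopy_lift_end {B E Z : SSet.{w}} (p : E ⟶ Z) [Fibration p]
    (ε : Fin 2) (H : B ⊗ Δ[1] ⟶ Z) (f : B ⟶ E) (hf : f ≫ p = cyl B ε ≫ H) :
    ∃ L : B ⊗ Δ[1] ⟶ E, L ≫ p = H ∧ cyl B ε ≫ L = f := by
  have := (SSet.anodyneExtensions.horn_ι.{w} (n := 1) ε).whiskerLeft B p (mem_fibrations p)
  have sq : CommSq (fst B (Λ[1, ε] : SSet.{w}) ≫ f)
    (B ◁ (Λ[1, ε] : SSet.Subcomplex.{w} _).ι) p H :=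
    ⟨by rw [Category.assoc, whiskerLeft_horn_comp_fst ε _ H hf]⟩
  exact ⟨sq.lift, sq.fac_right, cyl_comp_eq_of_horn _ _ _ sq.fac_left⟩

lemma boundaryDesc_comp {X Y Z : SSet.{w}} (f : Fin 2 → (X ⟶ Y)) (g : Y ⟶ Z) :
    boundaryDesc f ≫ g = boundaryDesc fun i ↦ f i ≫ g := rfl

lemma whiskerRight_boundaryDesc {X Y Z : SSet.{w}} (f : Fin 2 → (Y ⟶ Z)) (g : X ⟶ Y) :
    g ▷ _ ≫ boundaryDesc f = boundaryDesc fun i ↦ g ≫ f i := rfl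

lemma eq_boundaryDesc {X Y : SSet.{w}} (H : X ⊗ Δ[1] ⟶ Y) :
    X ◁ (∂Δ[1] : SSet.Subcomplex.{w} _).ι ≫ H = boundaryDesc fun i ↦ cyl X i ≫ H :=
  hom_ext_cyl fun _ _ _ _ ↦ rfl

lemma relative_homotopy_of_anodyne {A B E Z : SSet.{w}} (i : A ⟶ B) [Mono i]
    (hi : SSet.anodyneExtensions i) (p : E ⟶ Z) [Fibration p] (f g : B ⟶ E)
    (h : i ≫ f = i ≫ g) (hp : f ≫ p = g ≫ p) :
    ∃ L : B ⊗ Δ[1] ⟶ E, L ≫ p = fst _ _ ≫ f ≫ p ∧ cyl B 0 ≫ L = f ∧ cyl B 1 ≫ L = g ∧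
      i ▷ Δ[1] ≫ L = fst _ _ ≫ i ≫ f := by
  obtain ⟨L, h₁, h₂, h₃⟩ := pushoutProduct_lift i (∂Δ[1] : SSet.Subcomplex.{w} _).ι
    (.inl hi) p (fst _ _ ≫ f ≫ p) (boundaryDesc ![f, g]) (fst _ _ ≫ i ≫ f)
    (by
      rw [eq_boundaryDesc, whiskerRight_boundaryDesc]
      congr 1
      ext j : 1
      fin_cases j
      · rfl
      · exact h.symm)
    (by
      rw [eq_boundaryDesc, boundaryDesc_comp]
      congr 1
      ext j : 1
      fin_cases j
      · rfl
      · exact hp.symm)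
    rfl
  exact ⟨L, h₁, cyl_eq_of_boundary _ _ h₂ 0, cyl_eq_of_boundary _ _ h₂ 1, h₃⟩

/-- Anodyne extensions are right cancellable within monomorphisms. -/
lemma anodyne_of_comp {A B X : SSet.{w}} (i : A ⟶ B) (j : B ⟶ X) [Mono i] [Mono j]
    (hi : SSet.anodyneExtensions i) (hij : SSet.anodyneExtensions (i ≫ j)) :
    SSet.anodyneExtensions j := by
  intro E Z p hp
  have : Fibration p := (HomotopicalAlgebra.fibration_iff p).2 hp
  refine ⟨fun {e z} sq ↦ ?_⟩
  have := hij p hp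
  have sq' : CommSq (i ≫ e) (i ≫ j) p z := ⟨by simp [sq.w]⟩
  have hl := sq'.fac_left
  have hl' := sq'.fac_right
  generalize sq'.lift = l at hl hl'
  obtain ⟨L, h₁, h₂, h₃, -⟩ := relative_homotopy_of_anodyne i hi p (j ≫ l) e
    (by simpa using hl) (by simp [hl', sq.w])
  obtain ⟨R, r₁, r₂, r₃⟩ := homotopy_lift j p 0 (fst _ _ ≫ z) l hl' L
    (by rw [h₁, Category.assoc, hl']; rfl) h₂
  refine ⟨⟨⟨cyl X 1 ≫ R, ?_, ?_⟩⟩⟩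
  · rw [← cyl_whiskerRight_assoc, r₃, h₃]
  · rw [Category.assoc, r₁]; rfl

/-- A vertex inclusion is anodyne as soon as the identity can be connected to the constant map
by a zigzag of homotopies. -/
lemma anodyne_vertex_of_htpy {X : SSet.{w}} (v : Δ[0] ⟶ X) [Mono v] (c : X ⟶ Δ[0])
    (h : Htpy (𝟙 X) (c ≫ v)) : SSet.anodyneExtensions v := by
  intro E Z p hp
  have : Fibration p := (HomotopicalAlgebra.fibration_iff p).2 hp
  let LiftProp (a : X ⟶ X) : Prop := ∀ (b : X ⟶ Z) (e : Δ[0] ⟶ E), e ≫ p = v ≫ a ≫ b →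
    ∃ l : X ⟶ E, l ≫ p = a ≫ b ∧ v ≫ l = e
  have step (H : X ⊗ Δ[1] ⟶ X) (ε ε' : Fin 2) (hH : LiftProp (cyl X ε ≫ H)) :
      LiftProp (cyl X ε' ≫ H) := by
    intro b e he
    obtain ⟨q, q₁, q₂⟩ := homotopy_lift_end p ε' (v ▷ Δ[1] ≫ H ≫ b) e (by
      rw [cyl_whiskerRight_assoc, he, Category.assoc])
    obtain ⟨l, l₁, l₂⟩ := hH b (cyl _ ε ≫ q) (by
      rw [Category.assoc, q₁, cyl_whiskerRight_assoc, Category.assoc])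
    obtain ⟨L, L₁, L₂, L₃⟩ := homotopy_lift v p ε (H ≫ b) l (by rw [l₁, Category.assoc]) q q₁
      l₂.symm
    refine ⟨cyl X ε' ≫ L, by rw [Category.assoc, L₁, Category.assoc], ?_⟩
    rw [← cyl_whiskerRight_assoc, L₃, q₂]
  have key : ∀ a a' : X ⟶ X, Htpy a a' → (LiftProp a ↔ LiftProp a') := by
    intro a a' haa'
    induction haa' with
    | rel a a' h =>
      obtain ⟨H, rfl, rfl⟩ := (sHomotopy_iff _ _).1 h
      exact ⟨step H 0 1, step H 1 0⟩
    | refl => rfl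
    | symm _ _ _ ih => exact ih.symm
    | trans _ _ _ _ _ ih ih' => exact ih.trans ih'
  have hv : v ≫ c = 𝟙 _ := SSet.stdSimplex.isTerminalObj₀.hom_ext _ _
  have hid : LiftProp (𝟙 X) := (key _ _ h).2 fun b e he ↦
    ⟨c ≫ e, by rw [Category.assoc, he, Category.assoc, reassoc_of% hv],
      by rw [reassoc_of% hv]⟩
  refine ⟨fun {e z} sq ↦ ?_⟩
  obtain ⟨l, l₁, l₂⟩ := hid z e (by simpa using sq.w)
  exact ⟨⟨⟨l, l₂, by simpa using l₁⟩⟩⟩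

end Anodyne

section Lattice

variable {Y : SSet.{w}}

/-- An inclusion of subcomplexes which is an anodyne extension. -/
def AnodyneLE (A B : Y.Subcomplex) : Prop :=
  ∃ h : A ≤ B, SSet.anodyneExtensions (SSet.Subcomplex.homOfLE h)

lemma AnodyneLE.refl (A : Y.Subcomplex) : AnodyneLE A A :=
  ⟨le_rfl, SSet.anodyneExtensions.id_mem _⟩

lemma AnodyneLE.trans {A B X : Y.Subcomplex} (h : AnodyneLE A B) (h' : AnodyneLE B X) :
    AnodyneLE A X :=
  ⟨h.1.trans h'.1, SSet.anodyneExtensions.comp_mem _ _ h.2 h'.2⟩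

lemma AnodyneLE.cancel {A B X : Y.Subcomplex} (h : AnodyneLE A B) (hAX : AnodyneLE A X)
    (hBX : B ≤ X) : AnodyneLE B X :=
  ⟨hBX, anodyne_of_comp (SSet.Subcomplex.homOfLE h.1) _ h.2 hAX.2⟩

lemma AnodyneLE.sup {A B : Y.Subcomplex} (h : AnodyneLE (A ⊓ B) B) : AnodyneLE A (A ⊔ B) := by
  have sq : SSet.Subcomplex.BicartSq (A ⊓ B) B A (A ⊔ B) := ⟨sup_comm _ _, inf_comm _ _⟩
  exact ⟨le_sup_left, SSet.anodyneExtensions.of_isPushout sq.isPushout.flip h.2⟩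

lemma subcomplex_sup_inf (A B X : Y.Subcomplex) : (A ⊔ B) ⊓ X = A ⊓ X ⊔ B ⊓ X := by
  ext n z
  exact or_and_right

lemma anodyneLE_sup_finset {α ι : Type*} [SemilatticeInf α] (y : α → Y.Subcomplex)
    (hy : ∀ F G, y (F ⊓ G) = y F ⊓ y G) (s : Y.Subcomplex)
    (hs : ∀ F, AnodyneLE (s ⊓ y F) (y F)) (a : ι → α) (l : Finset ι) (F : α) :
    AnodyneLE ((s ⊔ l.sup fun i ↦ y (a i)) ⊓ y F) (y F) := by
  suffices h : ∀ F, AnodyneLE (s ⊓ y F) ((s ⊔ l.sup fun i ↦ y (a i)) ⊓ y F) from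
    (h F).cancel (hs F) inf_le_right
  classical
  induction l using Finset.induction_on with
  | empty => simpa using fun F ↦ AnodyneLE.refl _
  | insert i l _ ih =>
    intro F
    rw [Finset.sup_insert, sup_left_comm, sup_comm (y (a i)), subcomplex_sup_inf, ← hy]
    refine (ih F).trans (AnodyneLE.sup ?_)
    convert (ih (a i ⊓ F)).cancel (hs _) inf_le_right using 1
    rw [inf_assoc, ← hy, inf_left_comm, inf_idem]

end Lattice

section NerveHomotopy

open Simplicial MonoidalCategory CartesianMonoidalCategory

variable {C D : Type u} [Category.{v} C] [Category.{v} D]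

lemma nerveMap_comp {E : Type u} [Category.{v} E] (F : C ⥤ D) (G : D ⥤ E) :
    nerveMap (F ⋙ G) = nerveMap F ≫ nerveMap G := rfl

/-- The simplicial homotopy attached to a natural transformation. -/
def nerveHomotopy {F G : C ⥤ D} (α : F ⟶ G) : nerve C ⊗ Δ[1] ⟶ nerve D where
  app n := ↾fun z ↦ (show Fin (n.unop.len + 1) ⥤ D from
    Functor.prod' (SSet.stdSimplex.objEquiv z.2).toOrderHom.monotone.functor z.1 ⋙
      Functor.uncurry.obj (ComposableArrows.mk₁ α))
  naturality _ _ _ := by ext _; rfl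

lemma cyl_nerveHomotopy_zero {F G : C ⥤ D} (α : F ⟶ G) :
    cyl _ 0 ≫ nerveHomotopy α = nerveMap F := by
  ext n s
  exact CategoryTheory.Functor.hext (fun _ ↦ rfl) fun _ _ _ ↦ heq_of_eq (Category.id_comp _)

lemma cyl_nerveHomotopy_one {F G : C ⥤ D} (α : F ⟶ G) :
    cyl _ 1 ≫ nerveHomotopy α = nerveMap G := by
  ext n s
  exact CategoryTheory.Functor.hext (fun _ ↦ rfl) fun _ _ _ ↦ heq_of_eq (Category.id_comp _)

lemma htpy_nerveMap {F G : C ⥤ D} (α : F ⟶ G) : Htpy (nerveMap F) (nerveMap G) := by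
  rw [← cyl_nerveHomotopy_zero α, ← cyl_nerveHomotopy_one α]
  exact Htpy.of_cyl _

lemma IsWeakHomotopyEquiv.of_natTrans {F : C ⥤ D} (G : D ⥤ C)
    (h₁ : Htpy (nerveMap (F ⋙ G)) (nerveMap (𝟭 C)))
    (h₂ : Htpy (nerveMap (G ⋙ F)) (nerveMap (𝟭 D))) : IsWeakHomotopyEquiv (nerveMap F) :=
  .of_homotopyInverse (nerveMap G) h₁ h₂

lemma isWeakHomotopyEquiv_of_isEquivalence (F : C ⥤ D) [F.IsEquivalence] :
    IsWeakHomotopyEquiv (nerveMap F) :=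
  .of_natTrans F.inv (htpy_nerveMap F.asEquivalence.unitInv)
    (htpy_nerveMap F.asEquivalence.counit)

end NerveHomotopy

section SemiSimplices

open Opposite

/-- The objects of the category of semisimplices of a simplicial set. -/
structure SemiSimp (X : SSet.{w}) : Type w where
  dom : SimplexCategory
  simplex : X.obj (op dom)

namespace SemiSimp

/-- Morphisms of semisimplices: injective simplicial operators. -/
@[ext]
structure Hom {X : SSet.{w}} (s t : SemiSimp X) : Type w where
  toHom : s.dom ⟶ t.dom
  mono : Mono toHom
  map_simplex : X.map toHom.op t.simplex = s.simplex

instance (X : SSet.{w}) : Category.{w} (SemiSimp X) where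
  Hom := Hom
  id s := ⟨𝟙 _, inferInstance, by simp⟩
  comp f g := ⟨f.toHom ≫ g.toHom, by have := f.mono; have := g.mono; exact mono_comp _ _,
    by simp [f.map_simplex, g.map_simplex]⟩

@[ext]
lemma hom_ext {X : SSet.{w}} {s t : SemiSimp X} {f g : s ⟶ t} (h : f.toHom = g.toHom) : f = g :=
  Hom.ext h

@[simp]
lemma id_toHom {X : SSet.{w}} (s : SemiSimp X) : Hom.toHom (𝟙 s) = 𝟙 s.dom := rfl

@[simp]
lemma comp_toHom {X : SSet.{w}} {s t r : SemiSimp X} (f : s ⟶ t) (g : t ⟶ r) :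
    (f ≫ g).toHom = f.toHom ≫ g.toHom := rfl

/-- The forgetful functor to the simplex category. -/
@[simps]
def forget (X : SSet.{w}) : SemiSimp X ⥤ SimplexCategory where
  obj s := s.dom
  map f := f.toHom

instance (X : SSet.{w}) : (forget X).Faithful where
  map_injective h := hom_ext h

lemma functor_ext {X : SSet.{w}} {A : Type*} [Category* A] {F G : A ⥤ SemiSimp X}
    (h : ∀ a, F.obj a = G.obj a) (h' : F ⋙ forget X = G ⋙ forget X) : F = G := by
  refine CategoryTheory.Functor.ext h fun a b f ↦ (forget X).map_injective ?_
  rw [Functor.map_comp, Functor.map_comp, eqToHom_map, eqToHom_map]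
  exact CategoryTheory.Functor.congr_hom h' f

/-- Functoriality of the category of semisimplices. -/
def map {X Y : SSet.{w}} (f : X ⟶ Y) : SemiSimp X ⥤ SemiSimp Y where
  obj s := ⟨s.dom, f.app _ s.simplex⟩
  map φ := ⟨φ.toHom, φ.mono, by
    rw [← φ.map_simplex]
    exact (ConcreteCategory.congr_hom (f.naturality φ.toHom.op) _).symm⟩

/-- A semisimplex of `Δ[n]` viewed as a monotone map. -/
def toOrderHom {n : SimplexCategory} (s : SemiSimp (SSet.stdSimplex.{w}.obj n)) :
    Fin (s.dom.len + 1) →o Fin (n.len + 1) :=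
  (SSet.stdSimplex.objEquiv s.simplex).toOrderHom

lemma toOrderHom_toHom {n : SimplexCategory} {s t : SemiSimp (SSet.stdSimplex.{w}.obj n)}
    (f : s ⟶ t) (i : Fin (s.dom.len + 1)) :
    t.toOrderHom (f.toHom.toOrderHom i) = s.toOrderHom i :=
  congrArg (fun z ↦ (SSet.stdSimplex.objEquiv z).toOrderHom i) f.map_simplex

/-- The last vertex of a semisimplex of `Δ[n]`. -/
def last {n : SimplexCategory} (s : SemiSimp (SSet.stdSimplex.{w}.obj n)) : Fin (n.len + 1) :=
  s.toOrderHom (Fin.last _)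

lemma last_le {n : SimplexCategory} {s t : SemiSimp (SSet.stdSimplex.{w}.obj n)}
    (f : s ⟶ t) : s.last ≤ t.last := by
  rw [last, ← toOrderHom_toHom f]
  exact t.toOrderHom.monotone (Fin.le_last _)

/-- The map of standard simplices given by a morphism in the simplex category. -/
abbrev stdMap {n m : SimplexCategory} (φ : n ⟶ m) :
    SSet.stdSimplex.{w}.obj n ⟶ SSet.stdSimplex.{w}.obj m := SSet.stdSimplex.map φ

end SemiSimp

/-- The collage of the last vertex functor from the semisimplices of `Δ[n]` to `[n]`. -/
def Cograph (n : SimplexCategory) : Type w :=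
  SemiSimp (SSet.stdSimplex.{w}.obj n) ⊕ Fin (n.len + 1)

namespace Cograph

/-- Morphisms of the cograph. -/
def Hom {n : SimplexCategory} : Cograph.{w} n → Cograph.{w} n → Type w
  | Sum.inl s, Sum.inl t => s ⟶ t
  | Sum.inl s, Sum.inr i => ULift.{w} (PLift (s.last ≤ i))
  | Sum.inr i, Sum.inr j => ULift.{w} (PLift (i ≤ j))
  | Sum.inr _, Sum.inl _ => PEmpty

instance (n : SimplexCategory) : Category.{w} (Cograph.{w} n) where
  Hom := Hom
  id a := match a with
    | Sum.inl s => (𝟙 s : s ⟶ s)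
    | Sum.inr _ => ⟨⟨le_rfl⟩⟩
  comp {a b c} f g := match a, b, c, f, g with
    | Sum.inl _, Sum.inl _, Sum.inl _, f, g => f ≫ g
    | Sum.inl _, Sum.inl _, Sum.inr _, f, g => ⟨⟨(SemiSimp.last_le f).trans g.down.down⟩⟩
    | Sum.inl _, Sum.inr _, Sum.inr _, f, g => ⟨⟨f.down.down.trans g.down.down⟩⟩
    | Sum.inr _, Sum.inr _, Sum.inr _, f, g => ⟨⟨f.down.down.trans g.down.down⟩⟩
    | Sum.inl _, Sum.inr _, Sum.inl _, _, g => g.elim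
    | Sum.inr _, Sum.inl _, _, f, _ => f.elim
    | Sum.inr _, Sum.inr _, Sum.inl _, _, g => g.elim
  id_comp {a b} f := by
    rcases a with x|y <;> rcases b with x'|y' <;>
      first | exact f.elim | rfl | exact Category.id_comp (obj := SemiSimp _) _
  comp_id {a b} f := by
    rcases a with x|y <;> rcases b with x'|y' <;>
      first | exact f.elim | rfl | exact Category.comp_id (obj := SemiSimp _) _
  assoc {a b c d} f g h := by
    rcases a with xa|ya <;> rcases b with xb|yb <;> rcases c with xc|yc <;>
      rcases d with xd|yd <;>
      first | exact f.elim | exact g.elim | exact h.elim | rfl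

/-- The inclusion of the semisimplices in the cograph. -/
def inl (n : SimplexCategory) : SemiSimp (SSet.stdSimplex.{w}.obj n) ⥤ Cograph.{w} n where
  obj s := Sum.inl s
  map f := f

/-- The inclusion of the vertices in the cograph. -/
def inr (n : SimplexCategory) : Fin (n.len + 1) ⥤ Cograph.{w} n where
  obj i := Sum.inr i
  map f := ⟨⟨leOfHom f⟩⟩

/-- The retraction of the cograph on its vertices. -/
def ret {n : SimplexCategory} : Cograph.{w} n → Fin (n.len + 1)
  | Sum.inl s => s.last
  | Sum.inr i => i

lemma ret_le {n : SimplexCategory} {a b : Cograph.{w} n} (f : a ⟶ b) : ret a ≤ ret b := by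
  rcases a with x|y <;> rcases b with x'|y'
  · exact SemiSimp.last_le f
  · exact f.down.down
  · exact f.elim
  · exact f.down.down

/-- Functoriality of the cograph. -/
def map {n m : SimplexCategory} (φ : n ⟶ m) : Cograph.{w} n ⥤ Cograph.{w} m where
  obj
    | Sum.inl s => Sum.inl ((SemiSimp.map (SemiSimp.stdMap φ)).obj s)
    | Sum.inr i => Sum.inr (φ.toOrderHom i)
  map {a b} f := match a, b, f with
    | Sum.inl _, Sum.inl _, f => (SemiSimp.map (SemiSimp.stdMap φ)).map f
    | Sum.inl _, Sum.inr _, f => ⟨⟨φ.toOrderHom.monotone f.down.down⟩⟩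
    | Sum.inr _, Sum.inr _, f => ⟨⟨φ.toOrderHom.monotone f.down.down⟩⟩
    | Sum.inr _, Sum.inl _, f => f.elim
  map_id a := by
    rcases a with x|y <;> rfl
  map_comp {a b c} f g := by
    rcases a with xa|ya <;> rcases b with xb|yb <;> rcases c with xc|yc <;>
      first
        | exact f.elim | exact g.elim | rfl

lemma map_id (n : SimplexCategory) : map.{w} (𝟙 n) = 𝟭 _ := by
  have h : SemiSimp.map (SemiSimp.stdMap.{w} (𝟙 n)) = 𝟭 _ :=
    congrArg SemiSimp.map (CategoryTheory.Functor.map_id SSet.stdSimplex n)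
  refine CategoryTheory.Functor.hext ?_ ?_
  · rintro (x | y)
    · exact congrArg Sum.inl (CategoryTheory.Functor.congr_obj h x)
    · rfl
  · rintro (x | y) (x' | y') f
    · change (inl n).map ((SemiSimp.map (SemiSimp.stdMap (𝟙 n))).map f) ≍ (inl n).map ((𝟭 _).map f)
      rw [h]
    · exact Subsingleton.helim (congrArg (fun s ↦ ULift (PLift (SemiSimp.last s ≤ y')))
        (CategoryTheory.Functor.congr_obj h x)) _ _
    · exact f.elim
    · rfl

lemma map_comp {n m k : SimplexCategory} (φ : n ⟶ m) (ψ : m ⟶ k) :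
    map.{w} (φ ≫ ψ) = map φ ⋙ map ψ := by
  refine CategoryTheory.Functor.hext ?_ ?_
  · rintro (x | y) <;> rfl
  · rintro (x | y) (x' | y') f <;> first | exact f.elim | rfl

/-- The comparison between the two inclusions in the cograph. -/
def bridge {n : SimplexCategory} (s : SemiSimp (SSet.stdSimplex.{w}.obj n)) (i : Fin (n.len + 1))
    (h : s.last ≤ i) : (inl n).obj s ⟶ (inr n).obj i := ⟨⟨h⟩⟩

end Cograph

end SemiSimplices

section Supports

open Opposite

lemma exists_functor_lift {A B : Type*} [Category* A] [Category* B] (F : A ⥤ B) [F.Full]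
    [F.Faithful] {K : Type*} [Category* K] (G : K ⥤ B) (h : ∀ k, ∃ a, F.obj a = G.obj k) :
    ∃ H : K ⥤ A, H ⋙ F = G := by
  choose o ho using h
  refine ⟨{
    obj := o
    map := fun f ↦ F.preimage (eqToHom (ho _) ≫ G.map f ≫ eqToHom (ho _).symm)
    map_id := fun k ↦ F.map_injective (by simp)
    map_comp := fun f g ↦ F.map_injective (by simp) }, ?_⟩
  exact CategoryTheory.Functor.ext ho (by simp)

lemma functor_lift_unique {A B : Type*} [Category* A] [Category* B] (F : A ⥤ B)
    [F.Faithful] (hF : Function.Injective F.obj) {K : Type*} [Category* K] {G G' : K ⥤ A}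
    (h : G ⋙ F = G' ⋙ F) : G = G' := by
  refine CategoryTheory.Functor.ext (fun k ↦ hF (CategoryTheory.Functor.congr_obj h k))
    fun a b f ↦ F.map_injective ?_
  rw [Functor.map_comp, Functor.map_comp, eqToHom_map, eqToHom_map]
  exact CategoryTheory.Functor.congr_hom h f

lemma injective_of_mono {n m : SimplexCategory} (φ : n ⟶ m) [Mono φ] :
    Function.Injective φ.toOrderHom :=
  SimplexCategory.mono_iff_injective.1 inferInstance

lemma exists_factor_of_mono {k n m : SimplexCategory} (φ : n ⟶ m) [Mono φ] (f : k ⟶ m)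
    (h : ∀ i, f.toOrderHom i ∈ Set.range φ.toOrderHom) : ∃ g : k ⟶ n, g ≫ φ = f := by
  choose g hg using h
  refine ⟨SimplexCategory.Hom.mk ⟨g, fun i j hij ↦ ?_⟩, ?_⟩
  · have hφ : StrictMono φ.toOrderHom := φ.toOrderHom.monotone.strictMono_of_injective
      (injective_of_mono φ)
    rw [← hφ.le_iff_le, hg, hg]
    exact f.toOrderHom.monotone hij
  · ext i : 3
    exact hg i

namespace SemiSimp

variable {n m : SimplexCategory} (φ : n ⟶ m)

lemma map_stdMap_injective [Mono φ] :
    Function.Injective (map (stdMap.{w} φ)).obj := by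
  rintro ⟨d, x⟩ ⟨d', x'⟩ h
  obtain rfl : d = d' := congrArg dom h
  have h' : (stdMap φ).app _ x = (stdMap φ).app _ x' := by
    simpa [map] using h
  congr
  apply SSet.stdSimplex.objEquiv.injective
  rw [← cancel_mono φ]
  exact congrArg SSet.stdSimplex.objEquiv h'

lemma map_stdMap_full [Mono φ] {s t : SemiSimp (SSet.stdSimplex.{w}.obj n)}
    (f : (map (stdMap.{w} φ)).obj s ⟶ (map (stdMap φ)).obj t) :
    ∃ g : s ⟶ t, (map (stdMap φ)).map g = f := by
  refine ⟨⟨f.toHom, f.mono, SSet.stdSimplex.objEquiv.injective ?_⟩, rfl⟩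
  rw [← cancel_mono φ]
  exact congrArg SSet.stdSimplex.objEquiv f.map_simplex

lemma exists_map_stdMap [Mono φ] (t : SemiSimp (SSet.stdSimplex.{w}.obj m))
    (h : ∀ i, t.toOrderHom i ∈ Set.range φ.toOrderHom) : ∃ s, (map (stdMap φ)).obj s = t := by
  obtain ⟨d, x⟩ := t
  obtain ⟨g, hg⟩ := exists_factor_of_mono φ (SSet.stdSimplex.objEquiv x) h
  exact ⟨⟨d, SSet.stdSimplex.objEquiv.symm g⟩,
    congrArg (SemiSimp.mk d) (SSet.stdSimplex.objEquiv.injective hg)⟩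

end SemiSimp

namespace Cograph

variable {n m : SimplexCategory} (φ : n ⟶ m)

lemma map_obj_injective [Mono φ] : Function.Injective (map.{w} φ).obj := by
  rintro (x | y) (x' | y') h
  · exact congrArg Sum.inl (SemiSimp.map_stdMap_injective φ (Sum.inl_injective h))
  · exact (Sum.inl_ne_inr h).elim
  · exact (Sum.inr_ne_inl h).elim
  · exact congrArg Sum.inr (injective_of_mono φ (Sum.inr_injective h))

instance : (map.{w} φ).Faithful where
  map_injective {a b} f g h := by
    rcases a with x | y <;> rcases b with x' | y'
    · exact SemiSimp.hom_ext (f := f) (g := g) (congrArg SemiSimp.Hom.toHom h :)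
    · exact Subsingleton.elim (α := ULift (PLift _)) f g
    · exact f.elim
    · exact Subsingleton.elim (α := ULift (PLift _)) f g

instance [Mono φ] : (map.{w} φ).Full where
  map_surjective {a b} f := by
    have hφ : StrictMono φ.toOrderHom := φ.toOrderHom.monotone.strictMono_of_injective
      (injective_of_mono φ)
    rcases a with x | y <;> rcases b with x' | y'
    · exact SemiSimp.map_stdMap_full φ f
    · exact ⟨⟨⟨hφ.le_iff_le.1 f.down.down⟩⟩, rfl⟩
    · exact f.elim
    · exact ⟨⟨⟨hφ.le_iff_le.1 f.down.down⟩⟩, rfl⟩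

/-- The vertices of `[n]` involved in an object of the cograph. -/
def support {n : SimplexCategory} : Cograph.{w} n → Finset (Fin (n.len + 1))
  | Sum.inl s => Finset.univ.image s.toOrderHom
  | Sum.inr i => {i}

lemma support_nonempty {n : SimplexCategory} (a : Cograph.{w} n) : a.support.Nonempty := by
  rcases a with x | y
  · exact Finset.univ_nonempty.image _
  · exact Finset.singleton_nonempty y

lemma support_map (a : Cograph.{w} n) :
    support ((map φ).obj a) = a.support.image φ.toOrderHom := by
  rcases a with x | y
  · exact (Finset.image_image (f := x.toOrderHom) (g := φ.toOrderHom)).symm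
  · exact (Finset.image_singleton _ _).symm

lemma exists_map_obj [Mono φ] (a : Cograph.{w} m)
    (h : a.support ⊆ Finset.univ.image φ.toOrderHom) : ∃ a', (map φ).obj a' = a := by
  rcases a with x | y
  · obtain ⟨s, rfl⟩ := SemiSimp.exists_map_stdMap φ x fun i ↦ by
      simpa using h (Finset.mem_image_of_mem _ (Finset.mem_univ i))
    exact ⟨Sum.inl s, rfl⟩
  · obtain ⟨i, hi⟩ : ∃ i, φ.toOrderHom i = y := by
      simpa using h (Finset.mem_singleton_self y)
    exact ⟨Sum.inr i, congrArg Sum.inr hi⟩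

/-- The chains in the cograph with support in `F`. -/
def supported {n : SimplexCategory} (F : Finset (Fin (n.len + 1))) :
    (nerve (Cograph.{w} n)).Subcomplex where
  obj k := {z | ∀ j, support ((show Fin (k.unop.len + 1) ⥤ Cograph.{w} n from z).obj j) ⊆ F}
  map θ _ hz j := hz (θ.unop.toOrderHom j)

lemma supported_inf (F G : Finset (Fin (n.len + 1))) :
    supported.{w} (F ⊓ G) = supported F ⊓ supported G := by
  ext k z
  exact ⟨fun h ↦ ⟨fun j ↦ (h j).trans inf_le_left, fun j ↦ (h j).trans inf_le_right⟩,
    fun h j ↦ le_inf (h.1 j) (h.2 j)⟩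

lemma supported_empty : supported.{w} (∅ : Finset (Fin (n.len + 1))) = ⊥ := by
  ext k z
  exact ⟨fun h ↦ ((support_nonempty _).ne_empty (Finset.subset_empty.1 (h 0))).elim,
    fun h ↦ h.elim⟩

lemma supported_univ : supported.{w} (Finset.univ : Finset (Fin (n.len + 1))) = ⊤ := by
  ext k z
  exact ⟨fun _ ↦ trivial, fun _ _ ↦ Finset.subset_univ _⟩

lemma range_nerveMap_map [Mono φ] :
    SSet.Subcomplex.range (nerveMap (map.{w} φ)) = supported (Finset.univ.image φ.toOrderHom) := by
  ext k z
  constructor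
  · rintro ⟨z', rfl⟩ j
    exact (support_map φ _).trans_subset (Finset.image_subset_image (Finset.subset_univ _))
  · intro h
    obtain ⟨H, hH⟩ := exists_functor_lift (map φ)
      (show Fin (k.unop.len + 1) ⥤ Cograph.{w} m from z) fun j ↦ exists_map_obj φ _ (h j)
    exact ⟨H, hH⟩

lemma nerveMap_map_injective [Mono φ] (k : SimplexCategoryᵒᵖ) :
    Function.Injective ((nerveMap (map.{w} φ)).app k) := fun _ _ h ↦
  functor_lift_unique (map φ) (map_obj_injective φ) h

instance [Mono φ] : Mono (nerveMap (map.{w} φ)) := by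
  have (k : SimplexCategoryᵒᵖ) : Mono ((nerveMap (map.{w} φ)).app k) :=
    (CategoryTheory.mono_iff_injective _).2 (nerveMap_map_injective φ k)
  exact NatTrans.mono_of_mono_app _

end Cograph

end Supports

section Contraction

open Opposite

/-- The vertex of a nerve given by an object. -/
def vertexMap {C : Type u} [Category.{v} C] (c : C) :
    SSet.stdSimplex.{max u v}.obj (SimplexCategory.mk 0) ⟶ nerve C where
  app k := ↾fun _ ↦ (show Fin (k.unop.len + 1) ⥤ C from (Functor.const _).obj c)
  naturality _ _ _ := by ext _; rfl

instance {C : Type u} [Category.{v} C] (c : C) : Mono (vertexMap c) := by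
  have (k : SimplexCategoryᵒᵖ) : Mono ((vertexMap c).app k) := by
    refine (CategoryTheory.mono_iff_injective _).2 fun x y _ ↦
      SSet.stdSimplex.objEquiv.injective ?_
    ext i : 3
    exact Subsingleton.elim (α := Fin 1) _ _
  exact NatTrans.mono_of_mono_app _

lemma anodyne_vertexMap {C : Type u} [Category.{v} C] (c : C)
    (h : Htpy (nerveMap (𝟭 C)) (nerveMap ((Functor.const C).obj c))) :
    SSet.anodyneExtensions (vertexMap c) :=
  anodyne_vertex_of_htpy (vertexMap c) (SSet.stdSimplex.isTerminalObj₀.from _) h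

lemma vertexMap_nerveMap {C D : Type u} [Category.{v} C] [Category.{v} D] (F : C ⥤ D) (c : C) :
    vertexMap c ≫ nerveMap F = vertexMap (F.obj c) := by
  ext k z
  exact CategoryTheory.Functor.hext (fun _ ↦ rfl) fun _ _ _ ↦
    heq_of_eq (CategoryTheory.Functor.map_id F c)

lemma anodyne_nerveMap_of_contractions {C D : Type u} [Category.{v} C] [Category.{v} D] (F : C ⥤ D)
    [Mono (nerveMap F)] (c : C) (h : Htpy (nerveMap (𝟭 C)) (nerveMap ((Functor.const C).obj c)))
    (h' : Htpy (nerveMap (𝟭 D)) (nerveMap ((Functor.const D).obj (F.obj c)))) :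
    SSet.anodyneExtensions (nerveMap F) :=
  anodyne_of_comp (vertexMap c) _ (anodyne_vertexMap c h) (by
    rw [vertexMap_nerveMap]
    exact anodyne_vertexMap _ h')

/-- Extension of a monotone map by a new top element. -/
def extendTop {n m : ℕ} (f : Fin (n + 1) →o Fin (m + 1)) (t : Fin (m + 1)) (h : ∀ i, f i ≤ t) :
    Fin (n + 1 + 1) →o Fin (m + 1) where
  toFun i := Fin.lastCases (motive := fun _ ↦ Fin (m + 1)) t f i
  monotone' i j hij := by
    induction i using Fin.lastCases with
    | last =>
      obtain rfl : j = Fin.last _ := le_antisymm (Fin.le_last _) hij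
      exact le_rfl
    | cast i =>
      induction j using Fin.lastCases with
      | last => simpa using h i
      | cast j => simpa using f.monotone (Fin.castSucc_le_castSucc_iff.1 hij)

@[simp]
lemma extendTop_last {n m : ℕ} (f : Fin (n + 1) →o Fin (m + 1)) (t : Fin (m + 1))
    (h : ∀ i, f i ≤ t) : extendTop f t h (Fin.last _) = t :=
  Fin.lastCases_last (motive := fun _ ↦ Fin (m + 1))

@[simp]
lemma extendTop_castSucc {n m : ℕ} (f : Fin (n + 1) →o Fin (m + 1)) (t : Fin (m + 1))
    (h : ∀ i, f i ≤ t) (i : Fin (n + 1)) : extendTop f t h i.castSucc = f i :=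
  Fin.lastCases_castSucc (motive := fun _ ↦ Fin (m + 1)) _

/-- The join with a point of an operator. -/
def joinHom {n m : SimplexCategory} (f : n ⟶ m) :
    SimplexCategory.mk (n.len + 1) ⟶ SimplexCategory.mk (m.len + 1) :=
  SimplexCategory.Hom.mk (extendTop (Fin.castSuccOrderEmb.toOrderHom.comp f.toOrderHom)
    (Fin.last _) fun _ ↦ Fin.le_last _)

lemma joinHom_castSucc {n m : SimplexCategory} (f : n ⟶ m) (i : Fin (n.len + 1)) :
    (joinHom f).toOrderHom i.castSucc = (f.toOrderHom i).castSucc :=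
  extendTop_castSucc _ _ (fun _ ↦ Fin.le_last _) _

lemma joinHom_last {n m : SimplexCategory} (f : n ⟶ m) :
    (joinHom f).toOrderHom (Fin.last _) = Fin.last _ :=
  extendTop_last _ _ fun _ ↦ Fin.le_last _

lemma hom_ext_join {n m : SimplexCategory} {f g : SimplexCategory.mk (n.len + 1) ⟶ m}
    (h : ∀ i : Fin (n.len + 1), f.toOrderHom i.castSucc = g.toOrderHom i.castSucc)
    (h' : f.toOrderHom (Fin.last _) = g.toOrderHom (Fin.last _)) : f = g := by
  ext i : 3
  induction i using Fin.lastCases with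
  | last => exact h'
  | cast i => exact h i

/-- The join with the last vertex of `[n]`. -/
def joinLast {n m : SimplexCategory} (f : m ⟶ n) : SimplexCategory.mk (m.len + 1) ⟶ n :=
  SimplexCategory.Hom.mk (extendTop f.toOrderHom (Fin.last _) fun _ ↦ Fin.le_last _)

lemma joinLast_castSucc {n m : SimplexCategory} (f : m ⟶ n) (i : Fin (m.len + 1)) :
    (joinLast f).toOrderHom i.castSucc = f.toOrderHom i :=
  extendTop_castSucc _ _ (fun _ ↦ Fin.le_last _) _

lemma joinLast_last {n m : SimplexCategory} (f : m ⟶ n) :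
    (joinLast f).toOrderHom (Fin.last _) = Fin.last _ :=
  extendTop_last _ _ fun _ ↦ Fin.le_last _

lemma joinHom_comp_joinLast {n m k : SimplexCategory} (f : k ⟶ m) (g : m ⟶ n) :
    joinHom f ≫ joinLast g = joinLast (f ≫ g) :=
  hom_ext_join (fun i ↦ by
    change (joinLast g).toOrderHom ((joinHom f).toOrderHom i.castSucc) = _
    rw [joinHom_castSucc, joinLast_castSucc, joinLast_castSucc]
    rfl) (by
    change (joinLast g).toOrderHom ((joinHom f).toOrderHom (Fin.last _)) = _
    rw [joinHom_last, joinLast_last, joinLast_last])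

lemma joinHom_mono {n m : SimplexCategory} (f : n ⟶ m) [Mono f] : Mono (joinHom f) := by
  rw [SimplexCategory.mono_iff_injective]
  intro i j h
  induction i using Fin.lastCases with
  | last =>
    induction j using Fin.lastCases with
    | last => rfl
    | cast j =>
      have := (joinHom_last f).symm.trans (h.trans (joinHom_castSucc f j))
      exact absurd this.symm (Fin.castSucc_ne_last _)
  | cast i =>
    induction j using Fin.lastCases with
    | last =>
      have := (joinHom_castSucc f i).symm.trans (h.trans (joinHom_last f))
      exact absurd this (Fin.castSucc_ne_last _)
    | cast j =>
      have := (joinHom_castSucc f i).symm.trans (h.trans (joinHom_castSucc f j))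
      rw [injective_of_mono f (Fin.castSucc_injective _ this)]

namespace SemiSimp

variable (n : SimplexCategory)

/-- The semisimplex of `Δ[n]` at the last vertex. -/
def lastVertex : SemiSimp (SSet.stdSimplex.{w}.obj n) :=
  ⟨SimplexCategory.mk 0, SSet.stdSimplex.objEquiv.symm
    (SimplexCategory.const (SimplexCategory.mk 0) n (Fin.last _))⟩

/-- The join with the last vertex, as an endofunctor. -/
def join : SemiSimp (SSet.stdSimplex.{w}.obj n) ⥤ SemiSimp (SSet.stdSimplex.{w}.obj n) where
  obj s := ⟨SimplexCategory.mk (s.dom.len + 1),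
    SSet.stdSimplex.objEquiv.symm (joinLast (SSet.stdSimplex.objEquiv s.simplex))⟩
  map {s t} f := ⟨joinHom f.toHom, have := f.mono; joinHom_mono _,
    congrArg SSet.stdSimplex.objEquiv.symm ((joinHom_comp_joinLast _ _).trans
      (congrArg joinLast (congrArg SSet.stdSimplex.objEquiv f.map_simplex)))⟩
  map_id s := hom_ext (hom_ext_join (fun _ ↦ joinHom_castSucc _ _) (joinHom_last _))
  map_comp f g := hom_ext (hom_ext_join
    (fun i ↦ (joinHom_castSucc _ _).trans (by
      change _ = (joinHom g.toHom).toOrderHom ((joinHom f.toHom).toOrderHom i.castSucc)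
      rw [joinHom_castSucc, joinHom_castSucc]; rfl))
    ((joinHom_last _).trans (by
      change _ = (joinHom g.toHom).toOrderHom ((joinHom f.toHom).toOrderHom (Fin.last _))
      rw [joinHom_last, joinHom_last])))

/-- The inclusion of a semisimplex in its join with the last vertex. -/
def toJoin : 𝟭 _ ⟶ join.{w} n where
  app s := ⟨SimplexCategory.Hom.mk Fin.castSuccOrderEmb.toOrderHom,
    SimplexCategory.mono_iff_injective.2 (Fin.castSucc_injective _), by
      refine SSet.stdSimplex.objEquiv.injective ?_
      ext i : 3
      exact joinLast_castSucc _ _⟩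
  naturality s t f := hom_ext (by
    ext i : 3
    exact (joinHom_castSucc _ _).symm)

/-- The inclusion of the last vertex in a join. -/
def constToJoin : (Functor.const _).obj (lastVertex.{w} n) ⟶ join.{w} n where
  app s := ⟨SimplexCategory.const (SimplexCategory.mk 0) _ (Fin.last _),
    SimplexCategory.mono_iff_injective.2 (Function.injective_of_subsingleton (α := Fin 1) _), by
      refine SSet.stdSimplex.objEquiv.injective ?_
      ext i : 3
      exact joinLast_last _⟩
  naturality s t f := hom_ext (by
    ext i : 3
    exact (joinHom_last _).symm)

lemma htpy_const : Htpy (nerveMap (𝟭 (SemiSimp (SSet.stdSimplex.{w}.obj n))))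
    (nerveMap ((Functor.const _).obj (lastVertex.{w} n))) :=
  (htpy_nerveMap (toJoin n)).trans (htpy_nerveMap (constToJoin n)).symm

end SemiSimp

namespace Cograph

variable (n : SimplexCategory)

/-- The unique map to the terminal object of the cograph. -/
def toLast : 𝟭 (Cograph.{w} n) ⟶ (Functor.const _).obj (Sum.inr (Fin.last _) : Cograph.{w} n) where
  app a := match a with
    | Sum.inl _ => ⟨⟨Fin.le_last _⟩⟩
    | Sum.inr _ => ⟨⟨Fin.le_last _⟩⟩
  naturality a b f := by
    rcases a with x | y <;> rcases b with x' | y' <;> first | exact f.elim | rfl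

lemma htpy_inl_lastVertex : Htpy (nerveMap (𝟭 (Cograph.{w} n)))
    (nerveMap ((Functor.const _).obj ((inl n).obj (SemiSimp.lastVertex n)))) :=
  (htpy_nerveMap (toLast n)).trans (htpy_nerveMap ((Functor.const _).map
    (bridge (SemiSimp.lastVertex n) (Fin.last _) (Fin.le_last _)))).symm

lemma inl_obj_injective : Function.Injective (inl.{w} n).obj := Sum.inl_injective

instance : (inl.{w} n).Faithful where
  map_injective h := h

instance : (inl.{w} n).Full where
  map_surjective f := ⟨f, rfl⟩

instance : Mono (nerveMap (inl.{w} n)) := by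
  have (k : SimplexCategoryᵒᵖ) : Mono ((nerveMap (inl.{w} n)).app k) :=
    (CategoryTheory.mono_iff_injective _).2 fun _ _ h ↦
      functor_lift_unique (inl n) (inl_obj_injective n) h
  exact NatTrans.mono_of_mono_app _

lemma anodyne_nerveMap_inl : SSet.anodyneExtensions (nerveMap (inl.{w} n)) :=
  anodyne_nerveMap_of_contractions _ _ (SemiSimp.htpy_const n) (htpy_inl_lastVertex n)

end Cograph

end Contraction

section Relative

open Opposite

lemma AnodyneLE.range {A B X : SSet.{w}} (i : A ⟶ B) (j : B ⟶ X) [Mono i] [Mono j]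
    (hi : SSet.anodyneExtensions i) :
    AnodyneLE (SSet.Subcomplex.range (i ≫ j)) (SSet.Subcomplex.range j) := by
  have : Mono (i ≫ j) := mono_comp i j
  have h : SSet.Subcomplex.range (i ≫ j) ≤ SSet.Subcomplex.range j := by
    rintro k _ ⟨z, rfl⟩
    exact ⟨i.app k z, rfl⟩
  let e₁ : A ≅ (SSet.Subcomplex.range (i ≫ j) : SSet) := asIso (SSet.Subcomplex.toRange (i ≫ j))
  let e₂ : B ≅ (SSet.Subcomplex.range j : SSet) := asIso (SSet.Subcomplex.toRange j)
  exact ⟨h, (SSet.anodyneExtensions.arrow_mk_iso_iff (Arrow.isoMk e₁ e₂ rfl)).1 hi⟩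

namespace Cograph

lemma exists_mono_image_eq {n : SimplexCategory} {F : Finset (Fin (n.len + 1))}
    (hF : F.Nonempty) :
    ∃ (m : SimplexCategory) (φ : m ⟶ n) (_ : Mono φ), Finset.univ.image φ.toOrderHom = F := by
  obtain ⟨d, hd⟩ := Nat.exists_eq_add_one.2 hF.card_pos
  have h := F.range_orderEmbOfFin hd
  refine ⟨SimplexCategory.mk d, SimplexCategory.Hom.mk (F.orderEmbOfFin hd).toOrderHom,
    SimplexCategory.mono_iff_injective.2 (F.orderEmbOfFin hd).injective, ?_⟩
  rw [← Finset.coe_inj, ← h, Finset.coe_image, Finset.coe_univ, Set.image_univ]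
  rfl

/-- The chains of semisimplices, inside the nerve of the cograph. -/
abbrev semi (n : SimplexCategory) : (nerve (Cograph.{w} n)).Subcomplex :=
  SSet.Subcomplex.range (nerveMap (inl n))

variable {n m : SimplexCategory} (φ : m ⟶ n)

lemma exists_semi_of_map {k : SimplexCategoryᵒᵖ} (z : (nerve (Cograph.{w} m)).obj k)
    (h : (nerveMap (map φ)).app k z ∈ (semi n).obj k) : z ∈ (semi m).obj k := by
  obtain ⟨z', hz'⟩ := h
  obtain ⟨H, hH⟩ := exists_functor_lift (inl m)
    (show Fin (k.unop.len + 1) ⥤ Cograph.{w} m from z) fun j ↦ by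
      have := CategoryTheory.Functor.congr_obj hz' j
      change (inl n).obj _ = (map φ).obj _ at this
      revert this
      generalize (show Fin (k.unop.len + 1) ⥤ Cograph.{w} m from z).obj j = a
      intro this
      rcases a with x | y
      · exact ⟨x, rfl⟩
      · exact (Sum.inl_ne_inr this).elim
  exact ⟨H, hH⟩

lemma semi_inf_range [Mono φ] :
    semi.{w} n ⊓ SSet.Subcomplex.range (nerveMap (map.{w} φ)) =
      SSet.Subcomplex.range (nerveMap (inl.{w} m) ≫ nerveMap (map.{w} φ)) := by
  ext k z
  constructor
  · rintro ⟨hz, z', rfl⟩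
    obtain ⟨z'', rfl⟩ := exists_semi_of_map φ z' hz
    exact ⟨z'', rfl⟩
  · rintro ⟨z', rfl⟩
    exact ⟨⟨(nerveMap (SemiSimp.map (SemiSimp.stdMap φ))).app k z', rfl⟩, ⟨_, rfl⟩⟩

lemma anodyneLE_semi_inf_supported (F : Finset (Fin (n.len + 1))) :
    AnodyneLE (semi.{w} n ⊓ supported F) (supported F) := by
  rcases F.eq_empty_or_nonempty with rfl | hF
  · rw [supported_empty, inf_bot_eq]
    exact .refl _
  · obtain ⟨m, φ, _, rfl⟩ := exists_mono_image_eq hF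
    rw [← range_nerveMap_map, semi_inf_range]
    exact .range _ _ (anodyne_nerveMap_inl m)

/-- The chains in the cograph which are either chains of semisimplices or avoid some vertex. -/
def skeleton (n : SimplexCategory) : (nerve (Cograph.{w} n)).Subcomplex :=
  semi n ⊔ Finset.univ.sup fun i : Fin (n.len + 1) ↦ supported {i}ᶜ

lemma anodyne_skeleton (n : SimplexCategory) :
    SSet.anodyneExtensions (skeleton.{w} n).ι := by
  have := anodyneLE_sup_finset supported supported_inf (semi.{w} n)
    anodyneLE_semi_inf_supported (fun i ↦ {i}ᶜ) Finset.univ Finset.univ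
  rw [supported_univ, inf_top_eq] at this
  obtain ⟨h, h'⟩ := this
  exact SSet.anodyneExtensions.comp_mem _ _ h' (SSet.anodyneExtensions.of_isIso
    (SSet.Subcomplex.topIso _).hom)

lemma mem_finset_sup {Y : SSet.{w}} {ι : Type*} (l : Finset ι) (y : ι → Y.Subcomplex)
    {k : SimplexCategoryᵒᵖ} (z : Y.obj k) :
    z ∈ (l.sup y).obj k ↔ ∃ i ∈ l, z ∈ (y i).obj k := by
  classical
  induction l using Finset.induction_on with
  | empty => simp
  | insert i l _ ih =>
    rw [Finset.sup_insert]
    change z ∈ (y i).obj k ∨ z ∈ (l.sup y).obj k ↔ _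
    rw [ih]
    simp

lemma mem_skeleton_iff {k : SimplexCategoryᵒᵖ} (z : (nerve (Cograph.{w} n)).obj k) :
    z ∈ (skeleton n).obj k ↔ z ∈ (semi n).obj k ∨
      ∃ (m : SimplexCategory) (φ : m ⟶ n) (_ : Mono φ) (_ : ¬ Function.Surjective φ.toOrderHom)
        (z' : (nerve (Cograph.{w} m)).obj k), (nerveMap (map φ)).app k z' = z := by
  refine or_congr_right ((mem_finset_sup _ _ z).trans ⟨?_, ?_⟩)
  · rintro ⟨i, _, hi⟩
    have hne : (({i} : Finset (Fin (n.len + 1)))ᶜ).Nonempty :=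
      (support_nonempty _).mono (hi 0)
    obtain ⟨m, φ, _, hφ⟩ := exists_mono_image_eq hne
    rw [← hφ, ← range_nerveMap_map] at hi
    obtain ⟨z', hz'⟩ := hi
    refine ⟨m, φ, inferInstance, fun h ↦ ?_, z', hz'⟩
    have : i ∈ (({i} : Finset (Fin (n.len + 1)))ᶜ) := by
      rw [← hφ, Finset.mem_image]
      obtain ⟨j, hj⟩ := h i
      exact ⟨j, Finset.mem_univ _, hj⟩
    simp at this
  · rintro ⟨m, φ, _, hφ, z', rfl⟩
    obtain ⟨i, hi⟩ := not_forall.1 hφ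
    refine ⟨i, Finset.mem_univ _, fun j ↦ ?_⟩
    refine (support_map φ _).trans_subset fun l hl ↦ ?_
    obtain ⟨l, _, rfl⟩ := Finset.mem_image.1 hl
    simpa using fun h ↦ hi ⟨l, h⟩

end Cograph

end Relative

section Extension

open Opposite
open scoped SSet.modelCategoryQuillen

lemma exists_extension_of_anodyne {A B K : SSet.{w}} (i : A ⟶ B) (hi : SSet.anodyneExtensions i)
    (hK : SSet.KanComplex K) (f : A ⟶ K) : ∃ g : B ⟶ K, i ≫ g = f := by
  have := hi _ ((HomotopicalAlgebra.fibration_iff _).1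
    ((HomotopicalAlgebra.isFibrant_iff_of_isTerminal (terminal.from K) terminalIsTerminal).1 hK))
  have sq : CommSq f i (terminal.from K) (terminal.from B) := ⟨by simp⟩
  exact ⟨sq.lift, sq.fac_left⟩

lemma exists_hom_of_existsUnique {X K : SSet.{w}} (A : X.Subcomplex)
    (V : ∀ k : SimplexCategoryᵒᵖ, X.obj k → K.obj k → Prop)
    (hV : ∀ k, ∀ z ∈ A.obj k, ∃ v, V k z v) (hV' : ∀ k z v v', V k z v → V k z v' → v = v')
    (hnat : ∀ {k l} (θ : k ⟶ l) z v, V k z v → V l (X.map θ z) (K.map θ v)) :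
    ∃ c : (A : SSet) ⟶ K, ∀ k z v, (hz : z ∈ A.obj k) → V k z v → c.app k ⟨z, hz⟩ = v := by
  choose c hc using hV
  refine ⟨{
    app := fun k ↦ ↾fun z ↦ c k z.1 z.2
    naturality := fun k l θ ↦ ?_ }, fun k z v hz h ↦ hV' k z _ _ (hc k z hz) h⟩
  ext z
  exact hV' _ _ _ _ (hc _ _ _) (hnat θ _ _ (hc _ _ z.2))

namespace Cograph

lemma not_surjective_comp {l m n : SimplexCategory} (α : l ⟶ m) (φ : m ⟶ n)
    (hφ : ¬ Function.Surjective φ.toOrderHom) : ¬ Function.Surjective (α ≫ φ).toOrderHom :=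
  fun h ↦ hφ (Function.Surjective.of_comp (g := α.toOrderHom) h)

/-- Compatible families of maps to `K` from the chains in the cograph of `[n]` which are either
chains of semisimplices or contained in a proper face. -/
structure BoundaryData (n : SimplexCategory) (K : SSet.{w}) where
  semi : nerve (SemiSimp (SSet.stdSimplex.{w}.obj n)) ⟶ K
  face : ∀ {m : SimplexCategory} (φ : m ⟶ n), ¬ Function.Surjective φ.toOrderHom →
    (nerve (Cograph.{w} m) ⟶ K)
  inl_face : ∀ {m : SimplexCategory} (φ : m ⟶ n) (hφ : ¬ Function.Surjective φ.toOrderHom),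
    nerveMap (inl m) ≫ face φ hφ = nerveMap (SemiSimp.map (SemiSimp.stdMap φ)) ≫ semi
  face_comp : ∀ {l m : SimplexCategory} (α : l ⟶ m) (φ : m ⟶ n)
    (hφ : ¬ Function.Surjective φ.toOrderHom),
    face (α ≫ φ) (not_surjective_comp α φ hφ) = nerveMap (map α) ≫ face φ hφ

namespace BoundaryData

variable {n : SimplexCategory} {K : SSet.{w}} (d : BoundaryData n K)

/-- The prescribed values on the skeleton. -/
def Value (k : SimplexCategoryᵒᵖ) (z : (nerve (Cograph.{w} n)).obj k) (v : K.obj k) : Prop :=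
  (∃ z', (nerveMap (inl n)).app k z' = z ∧ d.semi.app k z' = v) ∨
    ∃ (m : SimplexCategory) (φ : m ⟶ n) (_ : Mono φ) (hφ : ¬ Function.Surjective φ.toOrderHom)
      (z' : (nerve (Cograph.{w} m)).obj k),
      (nerveMap (map φ)).app k z' = z ∧ (d.face φ hφ).app k z' = v

variable {d}

lemma Value.eq_semi {k : SimplexCategoryᵒᵖ}
    (z : (nerve (SemiSimp (SSet.stdSimplex.{w}.obj n))).obj k)
    {v : K.obj k} (h : d.Value k ((nerveMap (inl n)).app k z) v) : v = d.semi.app k z := by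
  obtain ⟨z', hz', rfl⟩ | ⟨m, φ, _, hφ, z', hz', rfl⟩ := h
  · exact congrArg _ (functor_lift_unique (inl n) (inl_obj_injective n) hz')
  · obtain ⟨z'', rfl⟩ := exists_semi_of_map φ z' ⟨z, hz'.symm⟩
    have h : (nerveMap (SemiSimp.map (SemiSimp.stdMap φ))).app k z'' = z :=
      functor_lift_unique (inl n) (inl_obj_injective n) hz'
    rw [← h]
    exact ConcreteCategory.congr_hom (NatTrans.congr_app (d.inl_face φ hφ) k) z''

lemma exists_common_face {k : SimplexCategoryᵒᵖ} {m m' : SimplexCategory} (φ : m ⟶ n) [Mono φ]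
    (φ' : m' ⟶ n) [Mono φ'] (z : (nerve (Cograph.{w} m)).obj k)
    (z' : (nerve (Cograph.{w} m')).obj k)
    (h : (nerveMap (map φ)).app k z = (nerveMap (map φ')).app k z') :
    ∃ (l : SimplexCategory) (α : l ⟶ m) (α' : l ⟶ m') (t : (nerve (Cograph.{w} l)).obj k),
      α ≫ φ = α' ≫ φ' ∧ (nerveMap (map α)).app k t = z ∧ (nerveMap (map α')).app k t = z' := by
  have hz : (nerveMap (map φ)).app k z ∈ (supported (Finset.univ.image φ.toOrderHom ⊓
      Finset.univ.image φ'.toOrderHom)).obj k := by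
    rw [supported_inf, ← range_nerveMap_map, ← range_nerveMap_map]
    exact ⟨⟨z, rfl⟩, ⟨z', h.symm⟩⟩
  obtain ⟨l, χ, _, hχ⟩ := exists_mono_image_eq ((support_nonempty _).mono (hz 0))
  have hχ' (i) : χ.toOrderHom i ∈ Finset.univ.image φ.toOrderHom ⊓
      Finset.univ.image φ'.toOrderHom := hχ ▸ Finset.mem_image_of_mem _ (Finset.mem_univ i)
  obtain ⟨α, hα⟩ := exists_factor_of_mono φ χ fun i ↦ by
    simpa using (Finset.mem_inter.1 (hχ' i)).1
  obtain ⟨α', hα'⟩ := exists_factor_of_mono φ' χ fun i ↦ by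
    simpa using (Finset.mem_inter.1 (hχ' i)).2
  rw [← hχ, ← range_nerveMap_map] at hz
  obtain ⟨t, ht⟩ := hz
  refine ⟨l, α, α', t, hα.trans hα'.symm, nerveMap_map_injective φ k ?_,
    nerveMap_map_injective φ' k ?_⟩
  · rw [← ht, ← hα, map_comp]
    rfl
  · rw [← h, ← ht, ← hα', map_comp]
    rfl

lemma Value.unique {k : SimplexCategoryᵒᵖ} {z : (nerve (Cograph.{w} n)).obj k} {v v' : K.obj k}
    (h : d.Value k z v) (h' : d.Value k z v') : v = v' := by
  obtain ⟨z, rfl, rfl⟩ | ⟨m, φ, _, hφ, z, rfl, rfl⟩ := h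
  · exact (h'.eq_semi z).symm
  · obtain ⟨z', hz', rfl⟩ | ⟨m', φ', _, hφ', z', hz', rfl⟩ := h'
    · exact Value.eq_semi (d := d) z' (hz' ▸ Or.inr ⟨m, φ, inferInstance, hφ, z, rfl, rfl⟩)
    · obtain ⟨l, α, α', t, hα, rfl, rfl⟩ := exists_common_face φ φ' z z' hz'.symm
      have h₁ := ConcreteCategory.congr_hom (NatTrans.congr_app (d.face_comp α φ hφ) k) t
      have h₂ := ConcreteCategory.congr_hom (NatTrans.congr_app (d.face_comp α' φ' hφ') k) t
      refine h₁.symm.trans (Eq.trans ?_ h₂)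
      congr 3
      simp only [hα]

lemma Value.map {k l : SimplexCategoryᵒᵖ} (θ : k ⟶ l) {z : (nerve (Cograph.{w} n)).obj k}
    {v : K.obj k} (h : d.Value k z v) :
    d.Value l ((nerve (Cograph.{w} n)).map θ z) (K.map θ v) := by
  obtain ⟨z, rfl, rfl⟩ | ⟨m, φ, _, hφ, z, rfl, rfl⟩ := h
  · exact Or.inl ⟨(nerve _).map θ z, rfl, ConcreteCategory.congr_hom (d.semi.naturality θ) z⟩
  · exact Or.inr ⟨m, φ, inferInstance, hφ, (nerve _).map θ z, rfl,
      ConcreteCategory.congr_hom ((d.face φ hφ).naturality θ) z⟩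

lemma exists_value {k : SimplexCategoryᵒᵖ} {z : (nerve (Cograph.{w} n)).obj k}
    (hz : z ∈ (skeleton n).obj k) : ∃ v, d.Value k z v := by
  obtain ⟨z', rfl⟩ | ⟨m, φ, _, hφ, z', rfl⟩ := (mem_skeleton_iff z).1 hz
  · exact ⟨_, Or.inl ⟨z', rfl, rfl⟩⟩
  · exact ⟨_, Or.inr ⟨m, φ, inferInstance, hφ, z', rfl, rfl⟩⟩

lemma exists_extension (d : BoundaryData n K) (hK : SSet.KanComplex K) :
    ∃ c : nerve (Cograph.{w} n) ⟶ K, nerveMap (inl n) ≫ c = d.semi ∧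
      ∀ {m : SimplexCategory} (φ : m ⟶ n) (hφ : ¬ Function.Surjective φ.toOrderHom),
        nerveMap (Cograph.map φ) ≫ c = d.face φ hφ := by
  obtain ⟨c₀, hc₀⟩ := exists_hom_of_existsUnique (skeleton n) d.Value (fun _ _ ↦ exists_value)
    (fun _ _ _ _ ↦ Value.unique) (fun θ _ _ ↦ Value.map θ)
  obtain ⟨c, hc⟩ : ∃ c : nerve (Cograph.{w} n) ⟶ K, (skeleton n).ι ≫ c = c₀ :=
    exists_extension_of_anodyne _ (anodyne_skeleton n) hK c₀
  have hc' {k z v} (h : d.Value k z v) (hz : z ∈ (skeleton n).obj k) : c.app k z = v := by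
    rw [← hc₀ k z v hz h, ← hc]
    rfl
  have hm {m : SimplexCategory} (φ : m ⟶ n) [Mono φ] (hφ : ¬ Function.Surjective φ.toOrderHom) :
      nerveMap (Cograph.map φ) ≫ c = d.face φ hφ := by
    ext k z
    exact hc' (Or.inr ⟨m, φ, inferInstance, hφ, z, rfl, rfl⟩)
      ((mem_skeleton_iff _).2 (Or.inr ⟨m, φ, inferInstance, hφ, z, rfl⟩))
  refine ⟨c, ?_, fun {m} φ hφ ↦ ?_⟩
  · ext k z
    exact hc' (Or.inl ⟨z, rfl, rfl⟩) ((mem_skeleton_iff _).2 (Or.inl ⟨z, rfl⟩))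
  · obtain ⟨l, μ, _, hμ⟩ := exists_mono_image_eq (F := Finset.univ.image φ.toOrderHom)
      (Finset.univ_nonempty.image _)
    obtain ⟨α, rfl⟩ := exists_factor_of_mono μ φ fun i ↦ by
      simpa using hμ.superset (Finset.mem_image_of_mem _ (Finset.mem_univ i))
    have hμ' : ¬ Function.Surjective μ.toOrderHom := fun h ↦ hφ fun i ↦ by
      obtain ⟨j, rfl⟩ := h i
      simpa using hμ.subset (Finset.mem_image_of_mem _ (Finset.mem_univ j))
    rw [d.face_comp α μ hμ', ← hm μ hμ', Cograph.map_comp]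
    rfl

end BoundaryData

end Cograph

end Extension

section HomSpaces

open Opposite
open scoped SSet.modelCategoryQuillen

lemma SemiSimp.map_stdMap_id (n : SimplexCategory) :
    SemiSimp.map (SemiSimp.stdMap.{w} (𝟙 n)) = 𝟭 _ :=
  congrArg SemiSimp.map (CategoryTheory.Functor.map_id SSet.stdSimplex n)

lemma app_eq_map_yonedaEquiv {X : SSet.{w}} {n m : SimplexCategory}
    (e : SSet.stdSimplex.{w}.obj n ⟶ X) (s : (SSet.stdSimplex.{w}.obj n).obj (op m)) :
    e.app (op m) s = X.map (SSet.stdSimplex.objEquiv s).op (SSet.yonedaEquiv e) := by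
  conv_lhs => rw [← SSet.yonedaEquiv.symm_apply_apply e]
  rfl

/-- The right adjoint of the barycentric-type subdivision `X ↦ nerve (SemiSimp X)`. -/
def semiHom (K : SSet.{w}) : SSet.{w} where
  obj n := nerve (SemiSimp (SSet.stdSimplex.{w}.obj n.unop)) ⟶ K
  map θ := ↾fun c ↦ nerveMap (SemiSimp.map (SemiSimp.stdMap θ.unop)) ≫ c
  map_id n := by
    refine ConcreteCategory.hom_ext _ _ fun c ↦ ?_
    exact congrArg (fun F ↦ nerveMap F ≫ c) (SemiSimp.map_stdMap_id n.unop)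
  map_comp θ θ' := rfl

/-- The simplicial set of maps from the nerves of the cographs. -/
def cographHom (K : SSet.{w}) : SSet.{w} where
  obj n := nerve (Cograph.{w} n.unop) ⟶ K
  map θ := ↾fun c ↦ nerveMap (Cograph.map θ.unop) ≫ c
  map_id n := by
    refine ConcreteCategory.hom_ext _ _ fun c ↦ ?_
    exact congrArg (fun F ↦ nerveMap F ≫ c) (Cograph.map_id n.unop)
  map_comp θ θ' := by
    refine ConcreteCategory.hom_ext _ _ fun c ↦ ?_
    exact congrArg (fun F ↦ nerveMap F ≫ c) (Cograph.map_comp θ'.unop θ.unop)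

/-- Restriction to semisimplices. -/
def toSemiHom (K : SSet.{w}) : cographHom K ⟶ semiHom K where
  app n := ↾fun c ↦ nerveMap (Cograph.inl n.unop) ≫ c
  naturality _ _ _ := rfl

/-- The tautological chain of vertices in the cograph. -/
def Cograph.vertices (n : SimplexCategoryᵒᵖ) : (nerve (Cograph.{w} n.unop)).obj n :=
  Cograph.inr n.unop

/-- Evaluation at the vertices. -/
def evVertices (K : SSet.{w}) : cographHom K ⟶ K where
  app n := ↾fun c ↦ c.app n (Cograph.vertices n)
  naturality n m θ := by
    ext c
    exact ConcreteCategory.congr_hom (c.naturality θ) (Cograph.vertices n)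

lemma rlp_toSemiHom (K : SSet.{w}) (hK : SSet.KanComplex K) :
    (MorphismProperty.monomorphisms SSet.{w}).rlp (toSemiHom K) := by
  rw [SSet.rlp_monomorphisms]
  rintro _ _ _ ⟨n⟩
  refine ⟨fun {b e} sq ↦ ?_⟩
  let d : Cograph.BoundaryData (SimplexCategory.mk n) K := {
    semi := SSet.yonedaEquiv e
    face := fun {m} φ hφ ↦ b.app (op m) ⟨SSet.stdSimplex.objEquiv.symm φ, hφ⟩
    inl_face := fun {m} φ hφ ↦ by
      refine (ConcreteCategory.congr_hom (NatTrans.congr_app sq.w (op m))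
        ⟨SSet.stdSimplex.objEquiv.symm φ, hφ⟩).trans ?_
      exact app_eq_map_yonedaEquiv e (SSet.stdSimplex.objEquiv.symm φ)
    face_comp := fun {l m} α φ hφ ↦
      ConcreteCategory.congr_hom (b.naturality α.op) ⟨SSet.stdSimplex.objEquiv.symm φ, hφ⟩ }
  obtain ⟨c, hc, hc'⟩ := d.exists_extension hK
  refine ⟨⟨{ l := SSet.yonedaEquiv.symm c, fac_left := ?_, fac_right := ?_}⟩⟩
  · ext k ⟨z, hz⟩
    exact hc' (SSet.stdSimplex.objEquiv z) hz
  · exact (SSet.yonedaEquiv_symm_comp _ _).trans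
      ((congrArg SSet.yonedaEquiv.symm hc).trans (SSet.yonedaEquiv.symm_apply_apply e))

end HomSpaces

section LastVertex

open Opposite

lemma map_map_eq_of_comp_eq {X : SSet.{w}} {a b c d : SimplexCategory} {f : a ⟶ b} {p : b ⟶ c}
    {g : a ⟶ d} {q : d ⟶ c} (h : f ≫ p = g ≫ q) (s : X.obj (op c)) :
    X.map f.op (X.map p.op s) = X.map g.op (X.map q.op s) := by
  have h' := congrArg (fun f ↦ X.map f.op s) h
  simpa using h'

namespace SemiSimp

variable {X Y : SSet.{w}}

/-- The chain of last vertices, as an operator to the top simplex of a chain. -/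
def lastOp {k : ℕ} (G : Fin (k + 1) ⥤ SemiSimp X) :
    SimplexCategory.mk k ⟶ (G.obj (Fin.last k)).dom :=
  SimplexCategory.mkHom
    { toFun := fun j ↦ (G.map (homOfLE (Fin.le_last j))).toHom.toOrderHom (Fin.last _)
      monotone' := fun i j hij ↦ by
        have h : G.map (homOfLE (Fin.le_last i)) =
          G.map (homOfLE hij) ≫ G.map (homOfLE (Fin.le_last j)) := by
          rw [← Functor.map_comp]
          rfl
        change (G.map (homOfLE (Fin.le_last i))).toHom.toOrderHom _ ≤ _
        rw [h]
        exact (G.map (homOfLE (Fin.le_last j))).toHom.toOrderHom.monotone (Fin.le_last _) }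

lemma map_map_toHom {k : ℕ} (G : Fin (k + 1) ⥤ SemiSimp X) {i j l : Fin (k + 1)} (f : i ⟶ j)
    (g : j ⟶ l) (h : i ⟶ l) : (G.map f).toHom ≫ (G.map g).toHom = (G.map h).toHom := by
  rw [← comp_toHom, ← Functor.map_comp]
  rfl

/-- The last vertex map. -/
def lastVertexMap (X : SSet.{w}) : nerve (SemiSimp X) ⟶ X where
  app k := ↾fun G ↦ X.map (lastOp G).op (G.obj (Fin.last _)).simplex
  naturality k l θ := by
    refine ConcreteCategory.hom_ext _ _ fun (G : Fin (k.unop.len + 1) ⥤ SemiSimp X) ↦ ?_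
    let p := (G.map (homOfLE (Fin.le_last (θ.unop.toOrderHom (Fin.last _)))))
    have h : lastOp (θ.unop.toOrderHom.monotone.functor ⋙ G) ≫ p.toHom = θ.unop ≫ lastOp G := by
      ext j : 3
      exact congrArg (fun f ↦ f.toOrderHom (Fin.last _)) (map_map_toHom G
        (homOfLE (θ.unop.toOrderHom.monotone (Fin.le_last j)))
        (homOfLE (Fin.le_last (θ.unop.toOrderHom (Fin.last _)))) (homOfLE (Fin.le_last _)))
    change X.map (lastOp (θ.unop.toOrderHom.monotone.functor ⋙ G)).op
      (G.obj (θ.unop.toOrderHom (Fin.last _))).simplex =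
      X.map θ (X.map (lastOp G).op (G.obj (Fin.last _)).simplex)
    rw [← p.map_simplex]
    exact map_map_eq_of_comp_eq h _

lemma nerveMap_map_lastVertexMap (f : X ⟶ Y) :
    nerveMap (map f) ≫ lastVertexMap Y = lastVertexMap X ≫ f := by
  ext k G
  exact (ConcreteCategory.congr_hom (f.naturality (lastOp G).op) _).symm

end SemiSimp

/-- The map from a standard simplex classifying a simplex. -/
abbrev simplexMap {X : SSet.{w}} {n : SimplexCategoryᵒᵖ} (x : X.obj n) :
    SSet.stdSimplex.{w}.obj n.unop ⟶ X := (SSet.yonedaEquiv (n := n.unop)).symm x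

lemma simplexMap_map {X : SSet.{w}} {n m : SimplexCategoryᵒᵖ} (θ : n ⟶ m) (x : X.obj n) :
    simplexMap (X.map θ x) =
      SemiSimp.stdMap θ.unop ≫ simplexMap x := by
  ext k s
  exact (ConcreteCategory.congr_hom (X.map_comp θ (SSet.stdSimplex.objEquiv (m := k) s).op) x).symm

/-- The adjoint of a map out of the nerve of the category of semisimplices. -/
def hatSemi {X K : SSet.{w}} (g : nerve (SemiSimp X) ⟶ K) : X ⟶ semiHom K where
  app n := ↾fun x ↦ nerveMap (SemiSimp.map (simplexMap x)) ≫ g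
  naturality n m θ := by
    refine ConcreteCategory.hom_ext _ _ fun x ↦ ?_
    exact congrArg (fun f ↦ nerveMap (SemiSimp.map f) ≫ g) (simplexMap_map θ x)

/-- A map out of `X` corresponds to a map out of the nerve of the category of semisimplices. -/
def LastRel {X K : SSet.{w}} (h : X ⟶ K) (g : nerve (SemiSimp X) ⟶ K) : Prop :=
  ∃ c : X ⟶ cographHom K, c ≫ toSemiHom K = hatSemi g ∧ c ≫ evVertices K = h

lemma exists_lastRel {X K : SSet.{w}} (hK : SSet.KanComplex K) (g : nerve (SemiSimp X) ⟶ K) :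
    ∃ h : X ⟶ K, LastRel h g := by
  have := rlp_toSemiHom K hK (initial.to X) (inferInstanceAs (Mono _))
  have sq : CommSq (initial.to (cographHom K)) (initial.to X) (toSemiHom K) (hatSemi g) :=
    ⟨by simp⟩
  exact ⟨_, sq.lift, sq.fac_right, rfl⟩

namespace Cograph

/-- The map of a chain in the cograph to the vertices. -/
def retMap (n : SimplexCategory) : nerve (Cograph.{w} n) ⟶ SSet.stdSimplex.{w}.obj n where
  app k := ↾fun z ↦ SSet.stdSimplex.objEquiv.symm (SimplexCategory.mkHom
    { toFun := fun j ↦ ret ((show Fin (k.unop.len + 1) ⥤ Cograph.{w} n from z).obj j)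
      monotone' := fun _ _ hij ↦
        ret_le ((show Fin (k.unop.len + 1) ⥤ Cograph.{w} n from z).map (homOfLE hij)) })
  naturality _ _ _ := rfl

lemma nerveMap_map_retMap {n m : SimplexCategory} (φ : n ⟶ m) :
    nerveMap (map.{w} φ) ≫ retMap m = retMap n ≫ SemiSimp.stdMap φ := by
  ext k z
  apply SSet.stdSimplex.objEquiv.injective
  ext j : 3
  change ret ((map φ).obj ((show Fin (k.unop.len + 1) ⥤ Cograph.{w} n from z).obj j)) =
    φ.toOrderHom (ret ((show Fin (k.unop.len + 1) ⥤ Cograph.{w} n from z).obj j))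
  generalize (show Fin (k.unop.len + 1) ⥤ Cograph.{w} n from z).obj j = a
  rcases a with a | a <;> rfl

lemma nerveMap_inl_retMap (n : SimplexCategory) :
    nerveMap (inl.{w} n) ≫ retMap n = SemiSimp.lastVertexMap _ := by
  ext k (G : Fin (k.unop.len + 1) ⥤ _)
  apply SSet.stdSimplex.objEquiv.injective
  ext j : 3
  exact (SemiSimp.toOrderHom_toHom (G.map (homOfLE (Fin.le_last j))) (Fin.last _)).symm

end Cograph

lemma lastRel_lastVertexMap {X K : SSet.{w}} (h : X ⟶ K) : LastRel h (SemiSimp.lastVertexMap X ≫ h) := by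
  refine ⟨{
    app := fun n ↦ ↾fun x ↦ Cograph.retMap n.unop ≫ simplexMap x ≫ h
    naturality := fun n m θ ↦ ?_ }, ?_, ?_⟩
  · refine ConcreteCategory.hom_ext _ _ fun x ↦ ?_
    change Cograph.retMap m.unop ≫ simplexMap (X.map θ x) ≫ h =
      nerveMap (Cograph.map θ.unop) ≫ Cograph.retMap n.unop ≫
        simplexMap x ≫ h
    rw [simplexMap_map, ← Category.assoc (nerveMap _), Cograph.nerveMap_map_retMap]
    rfl
  · refine NatTrans.ext (funext fun n ↦ ConcreteCategory.hom_ext _ _ fun x ↦ ?_)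
    change nerveMap (Cograph.inl _) ≫ Cograph.retMap _ ≫ simplexMap x ≫ h =
      (nerveMap (SemiSimp.map (simplexMap x)) ≫
        SemiSimp.lastVertexMap X) ≫ h
    rw [SemiSimp.nerveMap_map_lastVertexMap, ← Cograph.nerveMap_inl_retMap]
    rfl
  · ext n x
    have e : X.map (𝟙 n) x = x := ConcreteCategory.congr_hom (X.map_id n) x
    exact congrArg (h.app n) e

end LastVertex

section LastVertex

open Opposite

lemma isEmpty_hom_one_zero (f : (1 : Fin 2) ⟶ 0) : False := absurd (leOfHom f) (by decide)

namespace Cograph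

/-- The cylinder functor from the semisimplices of `Δ[n]` to the cograph. -/
def cylinder (n : SimplexCategory) :
    Fin 2 × SemiSimp (SSet.stdSimplex.{w}.obj n) ⥤ Cograph.{w} n where
  obj
    | (0, s) => Sum.inl s
    | (1, s) => Sum.inr s.last
  map {a b} f := match a, b, f with
    | (0, _), (0, _), f => f.2
    | (0, _), (1, _), f => ⟨⟨SemiSimp.last_le f.2⟩⟩
    | (1, _), (1, _), f => ⟨⟨SemiSimp.last_le f.2⟩⟩
    | (1, _), (0, _), f => (isEmpty_hom_one_zero f.1).elim
  map_id := by
    rintro ⟨i, s⟩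
    fin_cases i <;> rfl
  map_comp := by
    rintro ⟨i, s⟩ ⟨j, t⟩ ⟨k, r⟩ f g
    fin_cases i <;> fin_cases j <;> fin_cases k <;>
      first
        | rfl | exact (isEmpty_hom_one_zero f.1).elim | exact (isEmpty_hom_one_zero g.1).elim

lemma cylinder_map {n m : SimplexCategory} (φ : n ⟶ m) :
    cylinder.{w} n ⋙ map φ = (𝟭 _).prod (SemiSimp.map (SemiSimp.stdMap.{w} φ)) ⋙ cylinder.{w} m := by
  refine CategoryTheory.Functor.hext ?_ ?_
  · rintro ⟨i, s⟩
    fin_cases i <;> rfl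
  · rintro ⟨i, s⟩ ⟨j, t⟩ f
    fin_cases i <;> fin_cases j <;> first | rfl | exact (isEmpty_hom_one_zero f.1).elim

end Cograph

namespace SemiSimp

variable {X : SSet.{w}}

/-- A chain of semisimplices, viewed as a chain of faces of its top simplex. -/
def liftTop {k : ℕ} (G : Fin (k + 1) ⥤ SemiSimp X) :
    Fin (k + 1) ⥤ SemiSimp (SSet.stdSimplex.{w}.obj (G.obj (Fin.last k)).dom) where
  obj j := ⟨(G.obj j).dom, SSet.stdSimplex.objEquiv.symm (G.map (homOfLE (Fin.le_last j))).toHom⟩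
  map f := ⟨(G.map f).toHom, (G.map f).mono,
    congrArg SSet.stdSimplex.objEquiv.symm (map_map_toHom G f _ _)⟩
  map_id _ := by ext : 1; simp
  map_comp _ _ := by ext : 1; simp

lemma liftTop_map {k : ℕ} (G : Fin (k + 1) ⥤ SemiSimp X) :
    liftTop G ⋙ map (simplexMap (n := op _) (G.obj (Fin.last k)).simplex) = G :=
  functor_ext (fun j ↦ congrArg (SemiSimp.mk _) (G.map (homOfLE (Fin.le_last j))).map_simplex) rfl

lemma liftTop_precomp {k l : ℕ} (G : Fin (k + 1) ⥤ SemiSimp X) (θ : Fin (l + 1) →o Fin (k + 1)) :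
    liftTop (θ.monotone.functor ⋙ G) ⋙
      map (stdMap (G.map (homOfLE (Fin.le_last (θ (Fin.last l))))).toHom) =
    θ.monotone.functor ⋙ liftTop G :=
  functor_ext (fun j ↦ congrArg (SemiSimp.mk _) (congrArg SSet.stdSimplex.objEquiv.symm
    (map_map_toHom G (homOfLE (θ.monotone (Fin.le_last j))) _ _))) rfl

end SemiSimp

end LastVertex

section LastVertex

open Opposite MonoidalCategory CartesianMonoidalCategory
open scoped SSet.modelCategoryQuillen

variable {X K : SSet.{w}}

/-- The chain in a cograph attached to a chain in the cylinder on the category of semisimplices. -/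
def cylChain {k : ℕ} (G : Fin (k + 1) ⥤ SemiSimp X) (θ : Fin (k + 1) →o Fin 2) :
    Fin (k + 1) ⥤ Cograph.{w} (G.obj (Fin.last k)).dom :=
  Functor.prod' θ.monotone.functor (SemiSimp.liftTop G) ⋙ Cograph.cylinder _

lemma cylChain_precomp {k l : ℕ} (G : Fin (k + 1) ⥤ SemiSimp X) (θ : Fin (k + 1) →o Fin 2)
    (α : Fin (l + 1) →o Fin (k + 1)) :
    cylChain (α.monotone.functor ⋙ G) (θ.comp α) ⋙
      Cograph.map (G.map (homOfLE (Fin.le_last (α (Fin.last l))))).toHom =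
    α.monotone.functor ⋙ cylChain G θ := by
  refine (congrArg (fun F ↦ Functor.prod' (θ.comp α).monotone.functor
    (SemiSimp.liftTop (α.monotone.functor ⋙ G)) ⋙ F) (Cograph.cylinder_map _)).trans ?_
  exact congrArg (fun F ↦ Functor.prod' (θ.comp α).monotone.functor F ⋙ Cograph.cylinder.{w} _)
    (SemiSimp.liftTop_precomp G α)

lemma LastRel.sHomotopy {h : X ⟶ K} {g : nerve (SemiSimp X) ⟶ K} (H : LastRel h g) :
    SHomotopy g (SemiSimp.lastVertexMap X ≫ h) := by
  obtain ⟨c, hc, rfl⟩ := H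
  let Φ : nerve (SemiSimp X) ⊗ SSet.stdSimplex.{w}.obj (.mk 1) ⟶ K := {
    app := fun k ↦ ↾fun z ↦
      let G : Fin (k.unop.len + 1) ⥤ SemiSimp X := z.1
      (c.app _ (G.obj (Fin.last _)).simplex).app k
        (cylChain G (SSet.stdSimplex.objEquiv z.2).toOrderHom)
    naturality := fun k l θ ↦ by
      refine ConcreteCategory.hom_ext _ _ fun ⟨(G : Fin (k.unop.len + 1) ⥤ SemiSimp X), t⟩ ↦ ?_
      let p := G.map (homOfLE (Fin.le_last (θ.unop.toOrderHom (Fin.last _))))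
      have e₁ : c.app _ (G.obj (θ.unop.toOrderHom (Fin.last _))).simplex =
          nerveMap (Cograph.map p.toHom) ≫ c.app _ (G.obj (Fin.last _)).simplex := by
        rw [← p.map_simplex]
        exact ConcreteCategory.congr_hom (c.naturality p.toHom.op) _
      change (c.app _ (G.obj (θ.unop.toOrderHom (Fin.last _))).simplex).app l
        (cylChain (θ.unop.toOrderHom.monotone.functor ⋙ G)
          ((SSet.stdSimplex.objEquiv t).toOrderHom.comp θ.unop.toOrderHom)) =
        K.map θ ((c.app _ (G.obj (Fin.last _)).simplex).app k
          (cylChain G (SSet.stdSimplex.objEquiv t).toOrderHom))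
      rw [e₁]
      refine Eq.trans ?_ (ConcreteCategory.congr_hom
        ((c.app _ (G.obj (Fin.last _)).simplex).naturality θ) _)
      exact congrArg ((c.app _ (G.obj (Fin.last _)).simplex).app l)
        (cylChain_precomp G (SSet.stdSimplex.objEquiv t).toOrderHom θ.unop.toOrderHom) }
  refine (sHomotopy_iff _ _).2 ⟨Φ, ?_, ?_⟩
  · ext k (G : Fin (k.unop.len + 1) ⥤ SemiSimp X)
    have e : nerveMap (Cograph.inl _) ≫ c.app (op _) (G.obj (Fin.last _)).simplex =
        nerveMap (SemiSimp.map (simplexMap (n := op _) (G.obj (Fin.last _)).simplex)) ≫ g :=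
      ConcreteCategory.congr_hom (NatTrans.congr_app hc _) _
    refine (ConcreteCategory.congr_hom (NatTrans.congr_app e k) (SemiSimp.liftTop G)).trans ?_
    exact congrArg (g.app k) (SemiSimp.liftTop_map G)
  · ext k (G : Fin (k.unop.len + 1) ⥤ SemiSimp X)
    refine (ConcreteCategory.congr_hom ((c.app (op _) (G.obj (Fin.last _)).simplex).naturality
      (SemiSimp.lastOp G).op) (Cograph.vertices _)).trans ?_
    exact (ConcreteCategory.congr_hom ((c ≫ evVertices K).naturality (SemiSimp.lastOp G).op)
      (G.obj (Fin.last _)).simplex).symm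

/-- The adjoint of a homotopy. -/
def hatHomotopy (H : nerve (SemiSimp X) ⊗ SSet.stdSimplex.{w}.obj (.mk 1) ⟶ K) :
    X ⊗ SSet.stdSimplex.{w}.obj (.mk 1) ⟶ semiHom K where
  app n := ↾fun z ↦ lift (nerveMap (SemiSimp.map (simplexMap z.1)))
    (nerveMap (SemiSimp.map (simplexMap z.2)) ≫ SemiSimp.lastVertexMap _) ≫ H
  naturality n m θ := by
    refine ConcreteCategory.hom_ext _ _ fun ⟨x, t⟩ ↦ ?_
    change lift (nerveMap (SemiSimp.map (simplexMap (X.map θ x))))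
      (nerveMap (SemiSimp.map (simplexMap ((SSet.stdSimplex.{w}.obj (.mk 1)).map θ t))) ≫
        SemiSimp.lastVertexMap _) ≫ H = _
    rw [simplexMap_map, simplexMap_map]
    rfl

lemma nerveMap_map_const_lastVertexMap (n : SimplexCategory) (i : Fin 2) :
    nerveMap (SemiSimp.map (simplexMap (n := op n) (SSet.stdSimplex.objEquiv.symm
      (SimplexCategory.const n (.mk 1) i) : (SSet.stdSimplex.{w}.obj (.mk 1)).obj (op n)))) ≫
      SemiSimp.lastVertexMap (SSet.stdSimplex.{w}.obj (.mk 1)) = constVertex _ i := by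
  rw [SemiSimp.nerveMap_map_lastVertexMap]
  rfl

lemma cyl_hatHomotopy (H : nerve (SemiSimp X) ⊗ SSet.stdSimplex.{w}.obj (.mk 1) ⟶ K) (i : Fin 2) :
    cyl X i ≫ hatHomotopy H = hatSemi (cyl _ i ≫ H) := by
  refine NatTrans.ext (funext fun n ↦ ConcreteCategory.hom_ext _ _ fun x ↦ ?_)
  change lift (nerveMap (SemiSimp.map (simplexMap x)))
    (nerveMap (SemiSimp.map (simplexMap (n := op n.unop) (SSet.stdSimplex.objEquiv.symm
      (SimplexCategory.const n.unop (.mk 1) i) : (SSet.stdSimplex.{w}.obj (.mk 1)).obj _))) ≫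
        SemiSimp.lastVertexMap _) ≫ H = nerveMap (SemiSimp.map (simplexMap x)) ≫ cyl _ i ≫ H
  rw [nerveMap_map_const_lastVertexMap]
  exact (Category.assoc (nerveMap (SemiSimp.map (simplexMap x))) (cyl _ i) H)

lemma mono_whiskerLeft {Y Z : SSet.{w}} (X : SSet.{w}) (f : Y ⟶ Z) [Mono f] : Mono (X ◁ f) where
  right_cancellation g h H := by
    refine CartesianMonoidalCategory.hom_ext _ _ ?_ ?_
    · simpa using congrArg (· ≫ fst _ _) H
    · simpa [← cancel_mono f] using congrArg (· ≫ snd _ _) H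

lemma LastRel.htpy_of_sHomotopy (hK : SSet.KanComplex K) {h₀ h₁ : X ⟶ K}
    {g₀ g₁ : nerve (SemiSimp X) ⟶ K} (H₀ : LastRel h₀ g₀) (H₁ : LastRel h₁ g₁)
    (H : SHomotopy g₀ g₁) : Htpy h₀ h₁ := by
  obtain ⟨Φ, rfl, rfl⟩ := (sHomotopy_iff _ _).1 H
  obtain ⟨c₀, hc₀, rfl⟩ := H₀
  obtain ⟨c₁, hc₁, rfl⟩ := H₁
  have := rlp_toSemiHom K hK (X ◁ (SSet.boundary.{w} 1).ι) (mono_whiskerLeft _ _)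
  have sq : CommSq (boundaryDesc ![c₀, c₁]) (X ◁ (SSet.boundary.{w} 1).ι) (toSemiHom K)
      (hatHomotopy Φ) := ⟨by
    rw [eq_boundaryDesc, boundaryDesc_comp]
    congr 1
    ext j : 1
    rw [cyl_hatHomotopy]
    fin_cases j
    · exact hc₀
    · exact hc₁⟩
  have h (i) := cyl_eq_of_boundary _ _ sq.fac_left i
  generalize sq.lift = L at h
  obtain rfl : cyl X 0 ≫ L = c₀ := h 0
  obtain rfl : cyl X 1 ≫ L = c₁ := h 1
  exact Htpy.of_cyl (L ≫ evVertices K)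

lemma LastRel.htpy (hK : SSet.KanComplex K) {g₀ g₁ : nerve (SemiSimp X) ⟶ K} (H : Htpy g₀ g₁) :
    ∀ {h₀ h₁ : X ⟶ K}, LastRel h₀ g₀ → LastRel h₁ g₁ → Htpy h₀ h₁ := by
  induction H with
  | rel _ _ H => exact fun H₀ H₁ ↦ H₀.htpy_of_sHomotopy hK H₁ H
  | refl g =>
    intro h₀ h₁ H₀ H₁
    refine H₀.htpy_of_sHomotopy hK H₁ ((sHomotopy_iff _ _).2 ⟨fst _ _ ≫ g, ?_, ?_⟩) <;>
      rw [← Category.assoc, cyl_fst, Category.id_comp]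
  | symm _ _ _ ih => exact fun H₀ H₁ ↦ (ih H₁ H₀).symm
  | trans _ g _ _ _ ih₁ ih₂ =>
    intro h₀ h₁ H₀ H₁
    obtain ⟨h, H⟩ := exists_lastRel hK g
    exact (ih₁ H₀ H).trans (ih₂ H H₁)

/-- The last vertex map is a weak homotopy equivalence. -/
lemma isWeakHomotopyEquiv_lastVertexMap (X : SSet.{w}) :
    IsWeakHomotopyEquiv (SemiSimp.lastVertexMap X) := by
  refine fun K hK ↦ ⟨fun g ↦ ?_, fun h h' H ↦
    LastRel.htpy hK H (lastRel_lastVertexMap h) (lastRel_lastVertexMap h')⟩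
  obtain ⟨h, H⟩ := exists_lastRel hK g
  exact ⟨h, .symm (.rel _ _ H.sHomotopy)⟩

end LastVertex

section LastFunctor

open Opposite

section TopMap

variable {C : Type u} [Category.{v} C] {n m k : ℕ}

/-- The map to the last object of a chain from an object of a chain reindexing it. -/
def topMap {α : Fin (m + 1) →o Fin (n + 1)} {G : Fin (n + 1) ⥤ C} {F : Fin (m + 1) ⥤ C}
    (h : α.monotone.functor ⋙ G = F) (i : Fin (m + 1)) : F.obj i ⟶ G.obj (Fin.last n) :=
  eqToHom (CategoryTheory.Functor.congr_obj h i).symm ≫ G.map (homOfLE (Fin.le_last (α i)))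

lemma topMap_id {α : Fin (n + 1) →o Fin (n + 1)} {F : Fin (n + 1) ⥤ C}
    (h : α.monotone.functor ⋙ F = F) (hα : α = OrderHom.id) : topMap h (Fin.last n) = 𝟙 _ := by
  subst hα
  exact (Category.id_comp _).trans (F.map_id _)

lemma topMap_comp {α : Fin (m + 1) →o Fin (n + 1)} {β : Fin (k + 1) →o Fin (m + 1)}
    {γ : Fin (k + 1) →o Fin (n + 1)} {G : Fin (n + 1) ⥤ C} {F : Fin (m + 1) ⥤ C}
    {H : Fin (k + 1) ⥤ C} (h : α.monotone.functor ⋙ G = F) (h' : β.monotone.functor ⋙ F = H)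
    (h'' : γ.monotone.functor ⋙ G = H) (hγ : γ = α.comp β) (i : Fin (k + 1)) :
    topMap h' i ≫ topMap h (Fin.last m) = topMap h'' i := by
  subst hγ h h'
  simp only [topMap, eqToHom_refl]
  refine (congrArg₂ _ (Category.id_comp _) (Category.id_comp _)).trans
    (Eq.trans ?_ (Category.id_comp _).symm)
  exact (G.map_comp _ _).symm

lemma topMap_heq {α : Fin (m + 1) →o Fin (n + 1)} {β : Fin (k + 1) →o Fin (m + 1)}
    {γ : Fin (k + 1) →o Fin (n + 1)} {G : Fin (n + 1) ⥤ C} {F : Fin (m + 1) ⥤ C}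
    {H : Fin (k + 1) ⥤ C} (h : α.monotone.functor ⋙ G = F) (h' : β.monotone.functor ⋙ F = H)
    (hγ : γ = α.comp β) (i : Fin (k + 1)) (hi : γ i ≤ α (Fin.last m)) :
    topMap h' i ≍ G.map (homOfLE hi) := by
  subst hγ h h'
  exact heq_of_eq (Category.id_comp _)

end TopMap

namespace SemiSimp

variable {C D : Type w} [Category.{w} C] [Category.{w} D]

/-- A semisimplex of a nerve as a functor. -/
abbrev chain (s : SemiSimp (nerve C)) : Fin (s.dom.len + 1) ⥤ C := s.simplex

lemma functor_chain {s t : SemiSimp (nerve C)} (f : s ⟶ t) :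
    f.toHom.toOrderHom.monotone.functor ⋙ t.chain = s.chain := f.map_simplex

/-- The last vertex functor from the semisimplices of a nerve. -/
def lastFunctor (C : Type w) [Category.{w} C] : SemiSimp (nerve C) ⥤ C where
  obj s := s.chain.obj (Fin.last _)
  map f := topMap (functor_chain f) (Fin.last _)
  map_id _ := topMap_id _ rfl
  map_comp _ _ := (topMap_comp _ _ _ rfl _).symm

/-- Naturality of the last vertex functor. -/
def lastFunctorNat (F : C ⥤ D) :
    map (nerveMap F) ⋙ lastFunctor D ≅ lastFunctor C ⋙ F :=
  NatIso.ofComponents (fun _ ↦ Iso.refl _) fun {s t} f ↦ by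
    change (eqToHom _ ≫ F.map _) ≫ 𝟙 _ = 𝟙 _ ≫ F.map (eqToHom _ ≫ _)
    refine (Category.comp_id _).trans (Eq.trans ?_ (Category.id_comp _).symm)
    refine Eq.trans ?_ (F.map_comp _ _).symm
    exact congrArg (· ≫ _) (eqToHom_map F _).symm

lemma nerveMap_lastFunctor : nerveMap (lastFunctor C) = lastVertexMap (nerve C) := by
  refine NatTrans.ext (funext fun k ↦ ConcreteCategory.hom_ext _ _
    fun (G : Fin (k.unop.len + 1) ⥤ SemiSimp (nerve C)) ↦ ?_)
  let p (i : Fin (k.unop.len + 1)) : G.obj i ⟶ G.obj (Fin.last _) := G.map (homOfLE (Fin.le_last i))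
  change G ⋙ lastFunctor C = (lastOp G).toOrderHom.monotone.functor ⋙ (G.obj (Fin.last _)).chain
  refine CategoryTheory.Functor.hext
    (fun i ↦ (CategoryTheory.Functor.congr_obj (functor_chain (p i)) (Fin.last _)).symm) ?_
  intro i j f
  refine topMap_heq (γ := (p i).toHom.toOrderHom) (functor_chain (p j)) (functor_chain (G.map f)) ?_
    (Fin.last _) ((lastOp G).toOrderHom.monotone (leOfHom f))
  exact congrArg SimplexCategory.Hom.toOrderHom (map_map_toHom G f (homOfLE (Fin.le_last j))
    (homOfLE (Fin.le_last i))).symm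

lemma isWeakHomotopyEquiv_nerveMap_lastFunctor : IsWeakHomotopyEquiv (nerveMap (lastFunctor C)) :=
  nerveMap_lastFunctor (C := C) ▸ isWeakHomotopyEquiv_lastVertexMap _

end SemiSimp

/-- A fully faithful functor into `Q` induces a weak equivalence on nerves if the last vertex
functor of `Q` maps to a functor factoring through it. -/
lemma isWeakHomotopyEquiv_of_lastFunctor {P Q : Type w} [Category.{w} P] [Category.{w} Q]
    (ι : P ⥤ Q) [ι.Full] [ι.Faithful] (R : SemiSimp (nerve Q) ⥤ P)
    (r : SemiSimp.lastFunctor Q ⟶ R ⋙ ι) : IsWeakHomotopyEquiv (nerveMap ι) := by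
  let T := SemiSimp.map (nerveMap ι)
  let r' : SemiSimp.lastFunctor P ⋙ ι ⟶ (T ⋙ R) ⋙ ι :=
    (SemiSimp.lastFunctorNat ι).inv ≫ CategoryTheory.Functor.whiskerLeft T r
  let ρ : SemiSimp.lastFunctor P ⟶ T ⋙ R := ((Functor.FullyFaithful.ofFullyFaithful ι).whiskeringRight _).preimage r'
  have hT : nerveMap T ≫ nerveMap (SemiSimp.lastFunctor Q) =
      nerveMap (SemiSimp.lastFunctor P) ≫ nerveMap ι := by
    rw [SemiSimp.nerveMap_lastFunctor, SemiSimp.nerveMap_lastFunctor]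
    exact SemiSimp.nerveMap_map_lastVertexMap _
  intro K hK
  have hP := SemiSimp.isWeakHomotopyEquiv_nerveMap_lastFunctor (C := P) K hK
  have hQ := SemiSimp.isWeakHomotopyEquiv_nerveMap_lastFunctor (C := Q) K hK
  constructor
  · intro g
    obtain ⟨h, H⟩ := hQ.1 (nerveMap R ≫ g)
    refine ⟨h, hP.2 _ _ ?_⟩
    rw [← Category.assoc, ← hT, Category.assoc]
    refine (H.precomp (nerveMap T)).trans ?_
    rw [← Category.assoc, ← nerveMap_comp]
    exact ((htpy_nerveMap ρ).postcomp g).symm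
  · intro h h' H
    have key (h : nerve Q ⟶ K) : Htpy (nerveMap (SemiSimp.lastFunctor Q) ≫ h)
        (nerveMap R ≫ nerveMap ι ≫ h) := by
      rw [← Category.assoc, ← nerveMap_comp]
      exact (htpy_nerveMap r).postcomp h
    exact hQ.2 _ _ ((key h).trans ((H.precomp (nerveMap R)).trans (key h').symm))

end LastFunctor

section Reedy

namespace ModelStructure

variable {C : Type u} [Category.{v} C] (M : ModelStructure C)

lemma acof_of_llp {X Y : C} (f : X ⟶ Y) (h : M.Fib.llp f) : M.Cof f ∧ M.W f := by
  obtain ⟨Z, i, p, hi, hi', hp, rfl⟩ := M.fact_acof_fib f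
  have := h p hp
  have sq : CommSq i (i ≫ p) p (𝟙 Y) := ⟨by simp⟩
  have hr : IsRetractOf (i ≫ p) i := ⟨𝟙 _, 𝟙 _, sq.lift, p, by simp, by simp, by simp, by simp⟩
  exact ⟨M.Cof_retract hr hi, M.W_retract hr hi'⟩

lemma acof_iff_llp {X Y : C} (f : X ⟶ Y) : M.Cof f ∧ M.W f ↔ M.Fib.llp f :=
  ⟨fun h _ _ _ hp ↦ M.lifting_acof_fib _ _ h.1 h.2 hp, M.acof_of_llp f⟩

end ModelStructure

variable {T : Type w} [Category.{w} T]

/-- A degree function on a category without endomorphisms, with finitely many arrows of a given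
source degree into each object. -/
structure DirectDeg (T : Type w) [Category.{w} T] where
  deg : T → ℕ
  deg_le : ∀ {s t : T}, (s ⟶ t) → deg s ≤ deg t
  eq_of_deg_eq : ∀ {s t : T} (f : s ⟶ t), deg s = deg t → ∃ h : s = t, f = eqToHom h
  finite : ∀ (n : ℕ) (s : T), Finite (Σ t : {t : T // deg t = n}, (t.1 ⟶ s))

namespace DirectDeg

variable (d : DirectDeg T) {C : Type u} [Category.{v} C] {n : ℕ}

/-- The arrows into an object with source of given degree. -/
abbrev Idx (n : ℕ) (s : T) : Type w := Σ t : {t : T // d.deg t = n}, (t.1 ⟶ s)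

instance (n : ℕ) (s : T) : Finite (d.Idx n s) := d.finite n s

lemma idx_eq {s : T} (h : d.deg s = n) (p : d.Idx n s) : p = ⟨⟨s, h⟩, 𝟙 s⟩ := by
  obtain ⟨⟨t, ht⟩, f⟩ := p
  obtain ⟨rfl, rfl⟩ := d.eq_of_deg_eq f (ht.trans h.symm)
  rfl

variable [HasFiniteColimits C]

/-- The free functor on a family of objects indexed by the objects of a given degree. -/
noncomputable def free (A : {t : T // d.deg t = n} → C) : T ⥤ C where
  obj s := ∐ fun p : d.Idx n s ↦ A p.1
  map {s s'} f := Sigma.desc fun p ↦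
    Sigma.ι (fun p : d.Idx n s' ↦ A p.1) (⟨p.1, p.2 ≫ f⟩ : d.Idx n s')
  map_id s := Sigma.hom_ext _ _ fun p ↦ by
    rw [colimit.ι_desc, Category.comp_id]
    exact congrArg (β := A p.1 ⟶ ∐ fun p : d.Idx n s ↦ A p.1) (fun f ↦ Sigma.ι (fun p : d.Idx n s ↦ A p.1) ⟨p.1, f⟩)
      (Category.comp_id p.2)
  map_comp {s s' s''} f g := Sigma.hom_ext _ _ fun p ↦ by
    simp only [Sigma.ι_desc, Sigma.ι_desc_assoc]
    exact congrArg (β := A p.1 ⟶ ∐ fun p : d.Idx n s'' ↦ A p.1) (fun f ↦ Sigma.ι (fun p : d.Idx n s'' ↦ A p.1) ⟨p.1, f⟩)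
      (Category.assoc p.2 f g).symm

variable {A B : {t : T // d.deg t = n} → C} {s s' : T}

/-- The inclusion of a summand in a value of a free functor. -/
noncomputable def freeι (t : {t : T // d.deg t = n}) (f : t.1 ⟶ s) : A t ⟶ (d.free A).obj s :=
  Sigma.ι (fun p : d.Idx n s ↦ A p.1) ⟨t, f⟩

/-- The map out of a value of a free functor given by maps on the summands. -/
noncomputable def freeObjDesc {X : C} (a : ∀ (t : {t : T // d.deg t = n}) (_ : t.1 ⟶ s), A t ⟶ X) :
    (d.free A).obj s ⟶ X :=
  Sigma.desc fun p ↦ a p.1 p.2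

@[simp]
lemma freeι_map (t : {t : T // d.deg t = n}) (f : t.1 ⟶ s) (g : s ⟶ s') :
    d.freeι (A := A) t f ≫ (d.free A).map g = d.freeι t (f ≫ g) :=
  Sigma.ι_desc _ _

@[simp]
lemma freeι_desc {X : C} (a : ∀ (t : {t : T // d.deg t = n}) (_ : t.1 ⟶ s), A t ⟶ X)
    (t : {t : T // d.deg t = n}) (f : t.1 ⟶ s) : d.freeι t f ≫ d.freeObjDesc a = a t f :=
  Sigma.ι_desc _ _

@[simp]
lemma freeι_map_assoc (t : {t : T // d.deg t = n}) (f : t.1 ⟶ s) (g : s ⟶ s') {X : C}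
    (h : (d.free A).obj s' ⟶ X) :
    d.freeι t f ≫ (d.free A).map g ≫ h = d.freeι t (f ≫ g) ≫ h := by
  rw [← Category.assoc, freeι_map]

@[simp]
lemma freeι_desc_assoc {X Y : C} (a : ∀ (t : {t : T // d.deg t = n}) (_ : t.1 ⟶ s), A t ⟶ X)
    (t : {t : T // d.deg t = n}) (f : t.1 ⟶ s) (h : X ⟶ Y) :
    d.freeι t f ≫ d.freeObjDesc a ≫ h = a t f ≫ h := by
  rw [← Category.assoc, freeι_desc]

lemma free_hom_ext {X : C} {a b : (d.free A).obj s ⟶ X}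
    (h : ∀ t f, d.freeι t f ≫ a = d.freeι t f ≫ b) : a = b :=
  Sigma.hom_ext _ _ fun p ↦ h p.1 p.2

/-- The map out of a free functor induced by a family of maps. -/
@[simps]
noncomputable def freeDesc {F : T ⥤ C} (a : ∀ t, A t ⟶ F.obj t.1) : d.free A ⟶ F where
  app s := d.freeObjDesc fun t f ↦ a t ≫ F.map f
  naturality s s' f := d.free_hom_ext fun t g ↦ by simp

/-- The map of free functors induced by a family of maps. -/
@[simps]
noncomputable def freeMap (a : ∀ t, A t ⟶ B t) : d.free A ⟶ d.free B where
  app s := d.freeObjDesc fun t f ↦ a t ≫ d.freeι t f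
  naturality s s' f := d.free_hom_ext fun t g ↦ by simp

lemma isIso_freeι (h : d.deg s = n) : IsIso (d.freeι (A := A) ⟨s, h⟩ (𝟙 s)) := by
  refine ⟨d.freeObjDesc fun t f ↦ eqToHom
    (congrArg (fun p : d.Idx n s ↦ A p.1) (d.idx_eq h ⟨t, f⟩)), by simp,
    d.free_hom_ext fun t f ↦ ?_⟩
  have := d.idx_eq h ⟨t, f⟩
  simp only [Sigma.mk.injEq] at this
  obtain ⟨rfl, h⟩ := this
  obtain rfl := eq_of_heq h
  simp

lemma isIso_freeDesc_app {F : T ⥤ C} (h : d.deg s = n) :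
    IsIso ((d.freeDesc (fun t : {t : T // d.deg t = n} ↦ 𝟙 (F.obj t.1))).app s) := by
  have := d.isIso_freeι (A := fun t ↦ F.obj t.1) h
  have e : d.freeι ⟨s, h⟩ (𝟙 s) ≫
    (d.freeDesc (fun t : {t : T // d.deg t = n} ↦ 𝟙 (F.obj t.1))).app s = 𝟙 _ := by simp
  exact IsIso.of_isIso_fac_left e

lemma llp_freeMap_app (P : MorphismProperty C) (a : ∀ t, A t ⟶ B t) (h : ∀ t, P.llp (a t)) (s : T) :
    P.llp ((d.freeMap a).app s) := by
  intro X Y p hp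
  refine ⟨fun {f g} sq ↦ ?_⟩
  have (t : {t : T // d.deg t = n}) := h t p hp
  have sq' (t : {t : T // d.deg t = n}) (k : t.1 ⟶ s) :
      CommSq (d.freeι t k ≫ f) (a t) p (d.freeι t k ≫ g) := ⟨by
    rw [Category.assoc, sq.w]
    simp⟩
  exact ⟨⟨⟨d.freeObjDesc fun t k ↦ (sq' t k).lift, d.free_hom_ext fun t k ↦ by simp,
    d.free_hom_ext fun t k ↦ by simp⟩⟩⟩

variable (M : ModelStructure C)

/-- The maps making the objects of a given degree fibrant relative to a target. -/
lemma exists_step (n : ℕ) {R N : T ⥤ C} (p : R ⟶ N) :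
    ∃ (R' : T ⥤ C) (i : R ⟶ R') (p' : R' ⟶ N), i ≫ p' = p ∧
      (∀ s, M.Cof (i.app s) ∧ M.W (i.app s)) ∧ ∀ s, d.deg s = n → M.Fib (p'.app s) := by
  choose Z i q hi hi' hq hiq using fun t : {t : T // d.deg t = n} ↦ M.fact_acof_fib (p.app t.1)
  let e := d.freeDesc (fun t : {t : T // d.deg t = n} ↦ 𝟙 (R.obj t.1))
  have w : e ≫ p = d.freeMap i ≫ d.freeDesc q := by
    ext s
    refine d.free_hom_ext fun t f ↦ ?_
    simp [e, reassoc_of% hiq]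
  have po := IsPushout.of_hasPushout e (d.freeMap i)
  have po' (s) : IsPushout (e.app s) ((d.freeMap i).app s) ((pushout.inl e (d.freeMap i)).app s)
    ((pushout.inr e (d.freeMap i)).app s) := po.map ((evaluation T C).obj s)
  refine ⟨_, pushout.inl e (d.freeMap i), pushout.desc p (d.freeDesc q) w, pushout.inl_desc _ _ _,
    fun s ↦ ?_, fun s hs ↦ ?_⟩
  · refine M.acof_of_llp _ ?_
    exact MorphismProperty.of_isPushout (po' s) (d.llp_freeMap_app _ i
      (fun t ↦ (M.acof_iff_llp _).1 ⟨hi t, hi' t⟩) s)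
  · have h₁ := d.isIso_freeι (A := Z) hs
    have h₂ : IsIso (e.app s) := d.isIso_freeDesc_app hs
    have h₃ : IsIso ((pushout.inr e (d.freeMap i)).app s) := (po' s).isIso_inr_of_isIso
    have hfac : (d.freeι (A := Z) ⟨s, hs⟩ (𝟙 s) ≫ (pushout.inr e (d.freeMap i)).app s) ≫
          (pushout.desc p (d.freeDesc q) w).app s = q ⟨s, hs⟩ := by
      rw [Category.assoc, ← NatTrans.comp_app, pushout.inr_desc]
      simp
    refine M.Fib_retract ?_ (hq ⟨s, hs⟩)
    refine ⟨inv (d.freeι (A := Z) ⟨s, hs⟩ (𝟙 s) ≫ (pushout.inr e (d.freeMap i)).app s), _,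
      𝟙 _, 𝟙 _, IsIso.inv_hom_id _, Category.comp_id _, ?_, hfac.trans (Category.comp_id _).symm⟩
    rw [← hfac, IsIso.inv_hom_id_assoc, Category.comp_id]

/-- A functor between two functors on the way to a fibrant approximation. -/
structure Stage {L N : T ⥤ C} (α : L ⟶ N) where
  R : T ⥤ C
  m : L ⟶ R
  p : R ⟶ N
  fac : m ≫ p = α
  acof : ∀ s, M.Cof (m.app s) ∧ M.W (m.app s)

/-- Natural transformations between functors on a direct category factor as an objectwise acyclic
cofibration followed by an objectwise fibration. -/
lemma exists_factorization (d : DirectDeg T) {L N : T ⥤ C} (α : L ⟶ N) :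
    ∃ S : Stage M α, ∀ s, M.Fib (S.p.app s) := by
  choose R' i p' hfac hacof hfib using
    fun (n : ℕ) (S : Stage M α) ↦ d.exists_step M n S.p
  let next (n : ℕ) (S : Stage M α) : Stage M α :=
    ⟨R' n S, S.m ≫ i n S, p' n S, by rw [Category.assoc, hfac, S.fac],
      fun s ↦ ⟨M.Cof_comp _ _ (S.acof s).1 (hacof n S s).1,
        M.W_comp _ _ (S.acof s).2 (hacof n S s).2⟩⟩
  let stage (n : ℕ) : Stage M α := Nat.rec
    ⟨L, 𝟙 L, α, Category.id_comp α, fun s ↦ ⟨M.Cof_id _, M.W_id _⟩⟩ next n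
  let F : ℕ ⥤ T ⥤ C := Functor.ofSequence (X := fun n ↦ (stage n).R) fun n ↦ i n (stage n)
  have hF (n : ℕ) : F.map (homOfLE (Nat.le_add_right n 1)) = i n (stage n) :=
    Functor.ofSequence_map_homOfLE_succ _ n
  let mF : (Functor.const ℕ).obj L ⟶ F := NatTrans.ofSequence (fun n ↦ (stage n).m) fun n ↦ by
    rw [hF]
    exact Category.id_comp _
  let pF : F ⟶ (Functor.const ℕ).obj N := NatTrans.ofSequence (fun n ↦ (stage n).p) fun n ↦ by
    rw [hF]
    exact (hfac n (stage n)).trans (Category.comp_id _).symm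
  let δ : T ⥤ ℕ × T := Functor.prod'
    { obj := fun s ↦ d.deg s + 1, map := fun f ↦ homOfLE (Nat.succ_le_succ (d.deg_le f)) } (𝟭 T)
  refine ⟨⟨δ ⋙ Functor.uncurry.obj F,
    { app := fun s ↦ (stage (d.deg s + 1)).m.app s
      naturality := fun s t f ↦ ?_ },
    { app := fun s ↦ (stage (d.deg s + 1)).p.app s
      naturality := fun s t f ↦ ?_ }, ?_, fun s ↦ (stage (d.deg s + 1)).acof s⟩,
    fun s ↦ hfib _ _ _ rfl⟩
  · exact (congrArg (· ≫ _) (Category.id_comp _).symm).trans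
      ((Functor.uncurry.map mF).naturality (δ.map f))
  · exact ((Functor.uncurry.map pF).naturality (δ.map f)).trans
      (congrArg (_ ≫ ·) (Category.id_comp _))
  · ext s
    exact congrArg (fun η ↦ η.app s) (stage (d.deg s + 1)).fac

end DirectDeg

end Reedy

section CollageFactorization

open Opposite

/-- The degree function on the category of semisimplices given by dimension. -/
def SemiSimp.directDeg (X : SSet.{w}) : DirectDeg (SemiSimp X) where
  deg s := s.dom.len
  deg_le f := have := f.mono; SimplexCategory.len_le_of_mono f.toHom
  eq_of_deg_eq {s t} f h := by
    obtain ⟨a, x⟩ := s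
    obtain ⟨b, y⟩ := t
    obtain rfl : a = b := SimplexCategory.ext h
    have := f.mono
    have hf : f.toHom = 𝟙 a := SimplexCategory.eq_id_of_mono f.toHom
    obtain rfl : y = x := by
      have := f.map_simplex
      rw [hf] at this
      simpa using this
    exact ⟨rfl, SemiSimp.hom_ext hf⟩
  finite n s := by
    have : Finite (SimplexCategory.mk n ⟶ s.dom) :=
      Finite.of_injective (fun f ↦ (f.toOrderHom : Fin (n + 1) → Fin (s.dom.len + 1)))
        fun f g h ↦ by
          ext i : 3
          exact congrFun h i
    refine Finite.of_surjective (α := {g : SimplexCategory.mk n ⟶ s.dom // Mono g})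
      (fun g ↦ ⟨⟨⟨SimplexCategory.mk n, X.map g.1.op s.simplex⟩, rfl⟩, ⟨g.1, g.2, rfl⟩⟩) ?_
    rintro ⟨⟨⟨a, x⟩, rfl⟩, ⟨g, hg, hx⟩⟩
    refine ⟨⟨g, hg⟩, ?_⟩
    have key : ∀ (x : X.obj (op a)) (hx : X.map g.op s.simplex = x),
        (⟨⟨⟨a, X.map g.op s.simplex⟩, rfl⟩, ⟨g, hg, rfl⟩⟩ :
          Σ t : {t : SemiSimp X // t.dom.len = a.len}, (t.1 ⟶ s)) = ⟨⟨⟨a, x⟩, rfl⟩, ⟨g, hg, hx⟩⟩ := by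
      rintro _ rfl
      rfl
    exact key x hx

namespace Collage

variable {C : Type u} {D : Type u} [Category.{v} C] [Category.{v} D] {G : D ⥤ C}
  {PC : C → Prop} {PD : D → Prop}

/-- The side of the collage on which an object lies. -/
def isLeft : Collage G PC PD → Bool
  | Sum.inl _ => true
  | Sum.inr _ => false

lemma isLeft_eq_of_collW {WC : MorphismProperty C} {WD : MorphismProperty D}
    {a b : Collage G PC PD} {f : a ⟶ b} (h : collW G PC PD WC WD f) : a.isLeft = b.isLeft := by
  rcases a with x | y <;> rcases b with x' | y' <;> first | rfl | exact h.elim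

/-- The projection of the collage to its left side. -/
noncomputable def left [HasTerminal C] : Collage G PC PD ⥤ C where
  obj
    | Sum.inl x => x.1
    | Sum.inr _ => ⊤_ C
  map {a b} f := match a, b, f with
    | Sum.inl _, Sum.inl _, f => f
    | Sum.inl _, Sum.inr _, _ => terminal.from _
    | Sum.inr _, Sum.inr _, _ => 𝟙 _
    | Sum.inr _, Sum.inl _, f => f.elim
  map_id a := by rcases a with x | y <;> rfl
  map_comp {a b c} f g := by
    rcases a with x | y <;> rcases b with x' | y' <;> rcases c with x'' | y'' <;>
      first | exact f.elim | exact g.elim | rfl | exact Subsingleton.elim _ _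

/-- The projection of the collage to its right side. -/
noncomputable def right [HasInitial D] : Collage G PC PD ⥤ D where
  obj
    | Sum.inl _ => ⊥_ D
    | Sum.inr y => y.1
  map {a b} f := match a, b, f with
    | Sum.inl _, Sum.inl _, _ => 𝟙 _
    | Sum.inl _, Sum.inr _, _ => initial.to _
    | Sum.inr _, Sum.inr _, f => f
    | Sum.inr _, Sum.inl _, f => f.elim
  map_id a := by rcases a with x | y <;> rfl
  map_comp {a b c} f g := by
    rcases a with x | y <;> rcases b with x' | y' <;> rcases c with x'' | y'' <;>
      first | exact f.elim | exact g.elim | rfl | exact Subsingleton.elim _ _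

lemma prop_left [HasTerminal C] {a : Collage G PC PD} (h : a.isLeft = true) :
    PC (left.obj a) := by
  rcases a with x | y
  exacts [x.2, (Bool.false_ne_true h).elim]

lemma prop_right [HasInitial D] {a : Collage G PC PD} (h : a.isLeft = false) :
    PD (right.obj a) := by
  rcases a with x | y
  exacts [(Bool.false_ne_true h.symm).elim, y.2]

/-- The object on the same side as a given object with prescribed values on both sides. -/
def glueObj (a : Collage G PC PD) (c : C) (d : D) (hc : a.isLeft = true → PC c)
    (hd : a.isLeft = false → PD d) : Collage G PC PD :=
  match a with
  | Sum.inl _ => Sum.inl ⟨c, hc rfl⟩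
  | Sum.inr _ => Sum.inr ⟨d, hd rfl⟩

section

variable {a a' a'' : Collage G PC PD} {c c' c'' : C} {d d' d'' : D} {hc : a.isLeft = true → PC c}
    {hd : a.isLeft = false → PD d} {hc' : a'.isLeft = true → PC c'}
    {hd' : a'.isLeft = false → PD d'} {hc'' : a''.isLeft = true → PC c''}
    {hd'' : a''.isLeft = false → PD d''}

/-- The map of glued objects with prescribed values on both sides. -/
def glueMap (h : a.isLeft = a'.isLeft) (f : c ⟶ c') (g : d ⟶ d') :
    glueObj a c d hc hd ⟶ glueObj a' c' d' hc' hd' :=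
  match a, a', h with
  | Sum.inl _, Sum.inl _, _ => f
  | Sum.inl _, Sum.inr _, h => (Bool.false_ne_true h.symm).elim
  | Sum.inr _, Sum.inr _, _ => g
  | Sum.inr _, Sum.inl _, h => (Bool.false_ne_true h).elim

lemma glueMap_id : glueMap rfl (𝟙 c) (𝟙 d) = 𝟙 (glueObj a c d hc hd) := by
  rcases a with x | y <;> rfl

lemma glueMap_comp (h : a.isLeft = a'.isLeft) (h' : a'.isLeft = a''.isLeft) (f : c ⟶ c')
    (g : d ⟶ d') (f' : c' ⟶ c'') (g' : d' ⟶ d'') :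
    glueMap (h.trans h') (f ≫ f') (g ≫ g') =
      glueMap (hc := hc) (hd := hd) (hc' := hc') (hd' := hd') h f g ≫
        glueMap (hc' := hc'') (hd' := hd'') h' f' g' := by
  rcases a with x | y <;> rcases a' with x' | y' <;> rcases a'' with x'' | y'' <;>
    first | rfl | exact (Bool.false_ne_true h).elim | exact (Bool.false_ne_true h.symm).elim |
      exact (Bool.false_ne_true h').elim | exact (Bool.false_ne_true h'.symm).elim

variable [HasTerminal C] [HasInitial D]

/-- The map from an object of the collage to a glued object. -/
def toGlue (f : left.obj a ⟶ c) (g : right.obj a ⟶ d) : a ⟶ glueObj a c d hc hd :=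
  match a, f, g with
  | Sum.inl _, f, _ => f
  | Sum.inr _, _, g => g

/-- The map from a glued object to an object of the collage. -/
def ofGlue {a b : Collage G PC PD} {c : C} {d : D} {hc : a.isLeft = true → PC c}
    {hd : a.isLeft = false → PD d} (h : a.isLeft = b.isLeft) (f : c ⟶ left.obj b)
    (g : d ⟶ right.obj b) : glueObj a c d hc hd ⟶ b :=
  match a, b, h, f, g with
  | Sum.inl _, Sum.inl _, _, f, _ => f
  | Sum.inl _, Sum.inr _, h, _, _ => (Bool.false_ne_true h.symm).elim
  | Sum.inr _, Sum.inr _, _, _, g => g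
  | Sum.inr _, Sum.inl _, h, _, _ => (Bool.false_ne_true h).elim

lemma toGlue_glueMap (h : a.isLeft = a'.isLeft) (k : a ⟶ a') (f : left.obj a ⟶ c)
    (g : right.obj a ⟶ d) (f' : left.obj a' ⟶ c') (g' : right.obj a' ⟶ d') (p : c ⟶ c')
    (q : d ⟶ d') (hp : left.map k ≫ f' = f ≫ p) (hq : right.map k ≫ g' = g ≫ q) :
    k ≫ toGlue (hc := hc') (hd := hd') f' g' = toGlue (hc := hc) (hd := hd) f g ≫ glueMap h p q := by
  rcases a with x | y <;> rcases a' with x' | y' <;>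
    first | exact hp | exact hq | exact (Bool.false_ne_true h).elim |
      exact (Bool.false_ne_true h.symm).elim

lemma glueMap_ofGlue {b b' : Collage G PC PD} (h : a.isLeft = a'.isLeft) (hb : a.isLeft = b.isLeft)
    (hb' : a'.isLeft = b'.isLeft) (k : b ⟶ b') (f : c ⟶ left.obj b)
    (g : d ⟶ right.obj b) (f' : c' ⟶ left.obj b') (g' : d' ⟶ right.obj b') (p : c ⟶ c')
    (q : d ⟶ d') (hp : p ≫ f' = f ≫ left.map k) (hq : q ≫ g' = g ≫ right.map k) :
    glueMap (hc := hc) (hd := hd) (hc' := hc') (hd' := hd') h p q ≫ ofGlue hb' f' g' =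
      ofGlue (hc := hc) (hd := hd) hb f g ≫ k := by
  rcases a with x | y <;> rcases a' with x' | y' <;> rcases b with z | z <;> rcases b' with z' | z' <;>
    first | exact hp | exact hq | exact (Bool.false_ne_true h).elim |
      exact (Bool.false_ne_true h.symm).elim | exact (Bool.false_ne_true hb).elim |
      exact (Bool.false_ne_true hb.symm).elim | exact (Bool.false_ne_true hb').elim |
      exact (Bool.false_ne_true hb'.symm).elim

lemma toGlue_ofGlue (h : a.isLeft = a'.isLeft) (k : a ⟶ a') (f : left.obj a ⟶ c)
    (g : right.obj a ⟶ d) (f' : c ⟶ left.obj a') (g' : d ⟶ right.obj a')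
    (hf : f ≫ f' = left.map k) (hg : g ≫ g' = right.map k) :
    toGlue (hc := hc) (hd := hd) f g ≫ ofGlue h f' g' = k := by
  rcases a with x | y <;> rcases a' with x' | y' <;>
    first | exact hf | exact hg | exact (Bool.false_ne_true h).elim |
      exact (Bool.false_ne_true h.symm).elim

lemma collW_toGlue {WC : MorphismProperty C} {WD : MorphismProperty D} {f : left.obj a ⟶ c}
    {g : right.obj a ⟶ d} (hf : WC f) (hg : WD g) :
    collW G PC PD WC WD (toGlue (hc := hc) (hd := hd) f g) := by
  rcases a with x | y
  exacts [hf, hg]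

lemma collW_ofGlue {WC : MorphismProperty C} {WD : MorphismProperty D} (h : a.isLeft = a'.isLeft)
    {f : c ⟶ left.obj a'} {g : d ⟶ right.obj a'} (hf : WC f) (hg : WD g) :
    collW G PC PD WC WD (ofGlue (hc := hc) (hd := hd) h f g) := by
  rcases a with x | y <;> rcases a' with x' | y' <;>
    first | exact hf | exact hg | exact (Bool.false_ne_true h).elim |
      exact (Bool.false_ne_true h.symm).elim

end

end Collage

lemma Cofibrant.of_cof {C : Type u} [Category.{v} C] [HasInitial C] {M : ModelStructure C} {X Y : C}
    (hX : Cofibrant M X) {f : X ⟶ Y} (hf : M.Cof f) : Cofibrant M Y := by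
  have := M.Cof_comp _ _ hX hf
  rwa [Subsingleton.elim (initial.to X ≫ f) (initial.to Y)] at this

lemma Fibrant.of_fib {C : Type u} [Category.{v} C] [HasTerminal C] {M : ModelStructure C} {X Y : C}
    (hY : Fibrant M Y) {f : X ⟶ Y} (hf : M.Fib f) : Fibrant M X := by
  have := M.Fib_comp _ _ hf hY
  rwa [Subsingleton.elim (f ≫ terminal.from Y) (terminal.from X)] at this

/-- Natural weak equivalences between functors from a direct category to a collage factor as an
objectwise acyclic cofibration followed by an objectwise fibration. -/
lemma DirectDeg.exists_collage_factorization {T : Type w} [Category.{w} T] (δ : DirectDeg T)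
    {C : Type u} {D : Type u} [Category.{v} C] [Category.{v} D]
    [HasFiniteLimits C] [HasFiniteColimits C] [HasFiniteLimits D] [HasFiniteColimits D]
    {MC : ModelStructure C} {MD : ModelStructure D} (Q : QuillenAdjunction MC MD)
    {L N : T ⥤ Collage Q.G (Cofibrant MC) (Fibrant MD)} (α : L ⟶ N)
    (hL : ∀ {s t : T} (f : s ⟶ t), (collageDiag Q (Cofibrant MC) (Fibrant MD)).W (L.map f))
    (hα : ∀ s, (collageDiag Q (Cofibrant MC) (Fibrant MD)).W (α.app s)) :
    ∃ (R : T ⥤ Collage Q.G (Cofibrant MC) (Fibrant MD)) (m : L ⟶ R) (p : R ⟶ N), m ≫ p = α ∧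
      ∀ s, (collageDiag Q (Cofibrant MC) (Fibrant MD)).W (m.app s) ∧
        (collageDiag Q (Cofibrant MC) (Fibrant MD)).C (m.app s) ∧
        (collageDiag Q (Cofibrant MC) (Fibrant MD)).F (p.app s) := by
  have hL' {s t : T} (f : s ⟶ t) := Collage.isLeft_eq_of_collW (hL f)
  have hα' (s) := Collage.isLeft_eq_of_collW (hα s)
  obtain ⟨⟨RC, mC, pC, facC, acofC⟩, fibC⟩ :=
    δ.exists_factorization MC (CategoryTheory.Functor.whiskerRight α Collage.left)
  obtain ⟨⟨RD, mD, pD, facD, acofD⟩, fibD⟩ :=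
    δ.exists_factorization MD (CategoryTheory.Functor.whiskerRight α Collage.right)
  let R : T ⥤ Collage Q.G (Cofibrant MC) (Fibrant MD) :=
    { obj s := Collage.glueObj (L.obj s) (RC.obj s) (RD.obj s)
        (fun h ↦ (Collage.prop_left h).of_cof (acofC s).1)
        (fun h ↦ (Collage.prop_right ((hα' s).symm.trans h)).of_fib (fibD s))
      map f := Collage.glueMap (hL' f) (RC.map f) (RD.map f)
      map_id s := by
        rw [RC.map_id, RD.map_id]
        exact Collage.glueMap_id
      map_comp f g := by
        rw [RC.map_comp, RD.map_comp]
        exact Collage.glueMap_comp _ _ _ _ _ _ }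
  exact ⟨R,
    { app s := Collage.toGlue (mC.app s) (mD.app s)
      naturality s t f :=
        Collage.toGlue_glueMap (hL' f) _ _ _ _ _ _ _ (mC.naturality f) (mD.naturality f) },
    { app s := Collage.ofGlue (hα' s) (pC.app s) (pD.app s)
      naturality s t f := Collage.glueMap_ofGlue (hL' f) _ _ _ _ _ _ _ _ _
        (pC.naturality f) (pD.naturality f) },
    NatTrans.ext (funext fun s ↦ Collage.toGlue_ofGlue (hα' s) _ _ _ _ _
      (NatTrans.congr_app facC s) (NatTrans.congr_app facD s)),
    fun s ↦ ⟨Collage.collW_toGlue (acofC s).2 (acofD s).2,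
      Collage.collW_toGlue (acofC s).1 (acofD s).1,
      Collage.collW_ofGlue (hα' s) (fibC s) (fibD s)⟩⟩

end CollageFactorization

section WeakFactorizations

variable {I : Type u} {E : Type u} [Category.{v} I] [Category.{v} E]

/-- Diagrams of shape `I` with a factorization of the image of `w` as an acyclic cofibration
followed by a weak equivalence. -/
structure WeakFactorization (MI : ModelDiag I) (sI tI : I) (ME : ModelDiag E) (sE tE : E) {a b : I}
    (w : a ⟶ b) : Type (max u v) where
  diag : FunPt MI sI tI ME sE tE
  mid : E
  left : diag.func.obj a ⟶ mid
  right : mid ⟶ diag.func.obj b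
  left_W : ME.W left
  left_C : ME.C left
  right_W : ME.W right
  fac : left ≫ right = diag.func.map w

namespace WeakFactorization

variable {MI : ModelDiag I} {sI tI : I} {ME : ModelDiag E} {sE tE : E} {a b : I} {w : a ⟶ b}

/-- Morphisms of diagrams with a factorization. -/
@[ext]
structure Hom (S S' : WeakFactorization MI sI tI ME sE tE w) : Type (max u v) where
  diag : S.diag ⟶ S'.diag
  mid : S.mid ⟶ S'.mid
  left_mid : S.left ≫ mid = diag.1.app a ≫ S'.left
  mid_right : mid ≫ S'.right = S.right ≫ diag.1.app b

instance : Category.{max u v} (WeakFactorization MI sI tI ME sE tE w) where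
  Hom := Hom
  id S :=
    { diag := 𝟙 _
      mid := 𝟙 _
      left_mid := (Category.comp_id _).trans (Category.id_comp _).symm
      mid_right := (Category.id_comp _).trans (Category.comp_id _).symm }
  comp {S S' S''} f g :=
    { diag := f.diag ≫ g.diag
      mid := f.mid ≫ g.mid
      left_mid := by
        change _ = (f.diag.1.app a ≫ g.diag.1.app a) ≫ _
        rw [← Category.assoc, f.left_mid, Category.assoc, g.left_mid, Category.assoc]
      mid_right := by
        change _ = _ ≫ f.diag.1.app b ≫ g.diag.1.app b
        rw [Category.assoc, g.mid_right, ← Category.assoc, f.mid_right, Category.assoc] }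
  id_comp f := Hom.ext (Category.id_comp _) (Category.id_comp _)
  comp_id f := Hom.ext (Category.comp_id _) (Category.comp_id _)
  assoc f g h := Hom.ext (Category.assoc _ _ _) (Category.assoc _ _ _)

variable (MI sI tI ME sE tE w) in
/-- The functor forgetting the factorization. -/
def forget : WeakFactorization MI sI tI ME sE tE w ⥤ FunPt MI sI tI ME sE tE where
  obj S := S.diag
  map f := f.diag

variable (MI sI tI ME sE tE w) in
/-- The functor taking the middle object of the factorization. -/
def midFunctor : WeakFactorization MI sI tI ME sE tE w ⥤ E where
  obj S := S.mid
  map f := f.mid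

variable (MI sI tI ME sE tE) in
/-- Evaluation of diagrams at an object. -/
def _root_.Paper.FunPt.eval (i : I) : FunPt MI sI tI ME sE tE ⥤ E where
  obj X := X.func.obj i
  map f := f.1.app i

variable (MI sI tI ME sE tE w) in
/-- The second maps of the factorizations as a natural transformation. -/
def rightTrans : midFunctor MI sI tI ME sE tE w ⟶
    forget MI sI tI ME sE tE w ⋙ FunPt.eval MI sI tI ME sE tE b where
  app S := S.right
  naturality _ _ f := Hom.mid_right f

lemma Hom.mid_W {S S' : WeakFactorization MI sI tI ME sE tE w} (f : S ⟶ S') : ME.W (Hom.mid f) :=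
  ME.W_of_precomp S.left _ S.left_W
    (Hom.left_mid f ▸ ME.W_comp _ _ ((Hom.diag f).2.1 a) S'.left_W)

/-- The trivial factorizations. -/
def trivial (hw : MI.W w) : FunPt MI sI tI ME sE tE ⥤ WeakFactorization MI sI tI ME sE tE w where
  obj X :=
    { diag := X
      mid := X.func.obj a
      left := 𝟙 _
      right := X.func.map w
      left_W := ME.W_id _
      left_C := ME.C_id _
      right_W := X.map_W _ hw
      fac := Category.id_comp _ }
  map f :=
    { diag := f
      mid := f.1.app a
      left_mid := (Category.id_comp _).trans (Category.comp_id _).symm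
      mid_right := (f.1.naturality w).symm }

/-- The comparison from the trivial factorization to a given one. -/
def ofTrivial (hw : MI.W w) :
    forget MI sI tI ME sE tE w ⋙ trivial hw ⟶ 𝟭 (WeakFactorization MI sI tI ME sE tE w) where
  app S :=
    { diag := 𝟙 _
      mid := S.left
      left_mid := rfl
      mid_right := S.fac.trans (Category.comp_id _).symm }
  naturality _ _ f := Hom.ext ((Category.comp_id _).trans (Category.id_comp _).symm)
    (Hom.left_mid f).symm

lemma isWeakHomotopyEquiv_forget (hw : MI.W w) :
    IsWeakHomotopyEquiv (nerveMap (forget MI sI tI ME sE tE w)) :=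
  .of_natTrans (trivial hw) (htpy_nerveMap (ofTrivial hw)) (.refl _)

/-- Refine a factorization by factoring its second map. -/
def refineRight (S : WeakFactorization MI sI tI ME sE tE w) {M : E} (m : S.mid ⟶ M)
    (p : M ⟶ S.diag.func.obj b) (h : m ≫ p = S.right) (hW : ME.W m) (hC : ME.C m) :
    WeakFactorization MI sI tI ME sE tE w where
  diag := S.diag
  mid := M
  left := S.left ≫ m
  right := p
  left_W := ME.W_comp _ _ S.left_W hW
  left_C := ME.C_comp _ _ S.left_C hC
  right_W := ME.W_of_precomp m _ hW (h ▸ S.right_W)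
  fac := (Category.assoc _ _ _).trans ((congrArg (S.left ≫ ·) h).trans S.fac)

/-- Functoriality of refinements. -/
def refineRightMap {S S' : WeakFactorization MI sI tI ME sE tE w} (f : S ⟶ S') {M M' : E}
    {m : S.mid ⟶ M} {p : M ⟶ S.diag.func.obj b} {h : m ≫ p = S.right} {hW : ME.W m} {hC : ME.C m}
    {m' : S'.mid ⟶ M'} {p' : M' ⟶ S'.diag.func.obj b} {h' : m' ≫ p' = S'.right} {hW' : ME.W m'}
    {hC' : ME.C m'} (g : M ⟶ M') (hm : Hom.mid f ≫ m' = m ≫ g)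
    (hp : g ≫ p' = p ≫ (Hom.diag f).1.app b) :
    S.refineRight m p h hW hC ⟶ S'.refineRight m' p' h' hW' hC' where
  diag := (forget MI sI tI ME sE tE w).map f
  mid := g
  left_mid := (Category.assoc _ _ _).trans ((congrArg (S.left ≫ ·) hm.symm).trans
    ((Category.assoc _ _ _).symm.trans ((congrArg (· ≫ m') (Hom.left_mid f)).trans
      (Category.assoc _ _ _))))
  mid_right := hp

/-- The comparison from a factorization to its refinement. -/
def toRefineRight (S : WeakFactorization MI sI tI ME sE tE w) {M : E} (m : S.mid ⟶ M)
    (p : M ⟶ S.diag.func.obj b) (h : m ≫ p = S.right) (hW : ME.W m) (hC : ME.C m) :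
    S ⟶ S.refineRight m p h hW hC where
  diag := 𝟙 S.diag
  mid := m
  left_mid := (Category.id_comp _).symm
  mid_right := h.trans (Category.comp_id _).symm

variable (MI sI tI ME sE tE w) in
/-- The factorizations whose second map is a fibration. -/
def isFib : ObjectProperty (WeakFactorization MI sI tI ME sE tE w) := fun S ↦ ME.F S.right

lemma isWeakHomotopyEquiv_ι
    (H : ∀ {T : Type (max u v)} [Category.{max u v} T] (_ : DirectDeg T) {L N : T ⥤ E} (α : L ⟶ N),
      (∀ {s t : T} (f : s ⟶ t), ME.W (L.map f)) → (∀ s, ME.W (α.app s)) →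
      ∃ (R : T ⥤ E) (m : L ⟶ R) (p : R ⟶ N), m ≫ p = α ∧
        ∀ s, ME.W (m.app s) ∧ ME.C (m.app s) ∧ ME.F (p.app s)) :
    IsWeakHomotopyEquiv (nerveMap (isFib MI sI tI ME sE tE w).ι) := by
  let ℓ := SemiSimp.lastFunctor (WeakFactorization MI sI tI ME sE tE w)
  obtain ⟨R, m, p, hmp, h⟩ := H (SemiSimp.directDeg (nerve (WeakFactorization MI sI tI ME sE tE w)))
    (CategoryTheory.Functor.whiskerLeft ℓ (rightTrans MI sI tI ME sE tE w))
    (fun f ↦ Hom.mid_W (ℓ.map f)) (fun s ↦ (ℓ.obj s).right_W)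
  have hmp' (s) : m.app s ≫ p.app s = (ℓ.obj s).right := NatTrans.congr_app hmp s
  let R' : SemiSimp (nerve (WeakFactorization MI sI tI ME sE tE w)) ⥤
      WeakFactorization MI sI tI ME sE tE w :=
    { obj s := (ℓ.obj s).refineRight (m.app s) (p.app s) (hmp' s) (h s).1 (h s).2.1
      map f := refineRightMap (ℓ.map f) (R.map f) (m.naturality f) (p.naturality f)
      map_id s := Hom.ext ((ℓ ⋙ forget MI sI tI ME sE tE w).map_id s) (R.map_id s)
      map_comp f g := Hom.ext ((ℓ ⋙ forget MI sI tI ME sE tE w).map_comp f g) (R.map_comp f g) }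
  let r : ℓ ⟶ R' :=
    { app s := (ℓ.obj s).toRefineRight (m.app s) (p.app s) (hmp' s) (h s).1 (h s).2.1
      naturality _ _ f := Hom.ext ((Category.comp_id _).trans (Category.id_comp _).symm)
        (m.naturality f) }
  exact isWeakHomotopyEquiv_of_lastFunctor _
    ((isFib MI sI tI ME sE tE w).lift R' fun s ↦ (h s).2.2) r

end WeakFactorization

end WeakFactorizations

section FreeFactorizations

/-- The model diagram structure induced on a category with objects mapping to a model diagram. -/
def ModelDiag.induced {E : Type w} [Category.{v} E] (ME : ModelDiag E) {S : Type u} (f : S → E) :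
    ModelDiag (InducedCategory E f) where
  W _ _ g := ME.W g.hom
  C _ _ g := ME.C g.hom
  F _ _ g := ME.F g.hom
  W_id _ := ME.W_id _
  C_id _ := ME.C_id _
  F_id _ := ME.F_id _
  W_comp _ _ := ME.W_comp _ _
  C_comp _ _ := ME.C_comp _ _
  F_comp _ _ := ME.F_comp _ _
  W_of_precomp _ _ := ME.W_of_precomp _ _
  W_of_postcomp _ _ := ME.W_of_postcomp _ _

/-- The objectwise model diagram structure on arrows. -/
def ModelDiag.arrow {E : Type u} [Category.{v} E] (ME : ModelDiag E) : ModelDiag (Arrow E) where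
  W _ _ g := ME.W g.left ∧ ME.W g.right
  C _ _ g := ME.C g.left ∧ ME.C g.right
  F _ _ g := ME.F g.left ∧ ME.F g.right
  W_id _ := ⟨ME.W_id _, ME.W_id _⟩
  C_id _ := ⟨ME.C_id _, ME.C_id _⟩
  F_id _ := ⟨ME.F_id _, ME.F_id _⟩
  W_comp _ _ h h' := ⟨ME.W_comp _ _ h.1 h'.1, ME.W_comp _ _ h.2 h'.2⟩
  C_comp _ _ h h' := ⟨ME.C_comp _ _ h.1 h'.1, ME.C_comp _ _ h.2 h'.2⟩
  F_comp _ _ h h' := ⟨ME.F_comp _ _ h.1 h'.1, ME.F_comp _ _ h.2 h'.2⟩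
  W_of_precomp _ _ h h' := ⟨ME.W_of_precomp _ _ h.1 h'.1, ME.W_of_precomp _ _ h.2 h'.2⟩
  W_of_postcomp _ _ h h' := ⟨ME.W_of_postcomp _ _ h.1 h'.1, ME.W_of_postcomp _ _ h.2 h'.2⟩

variable {I : Type u} {J : Type u} {E : Type u} [Category.{v} I] [Category.{v} J] [Category.{v} E]
  {MI : ModelDiag I} {MJ : ModelDiag J} {ME : ModelDiag E}

/-- The forgetful morphism from an induced model diagram. -/
def ModelDiag.inducedHom (ME : ModelDiag E) {S : Type u} (f : S → E) :
    MDHom (ME.induced f) ME where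
  func := inducedFunctor f
  map_W _ h := h
  map_C _ h := h
  map_F _ h := h

/-- The source as a morphism of model diagrams. -/
def ModelDiag.arrowSource (ME : ModelDiag E) {S : Type u} (f : S → Arrow E) :
    MDHom (ME.arrow.induced f) ME where
  func := inducedFunctor f ⋙ Arrow.leftFunc
  map_W _ h := h.1
  map_C _ h := h.1
  map_F _ h := h.1

/-- The target as a morphism of model diagrams. -/
def ModelDiag.arrowTarget (ME : ModelDiag E) {S : Type u} (f : S → Arrow E) :
    MDHom (ME.arrow.induced f) ME where
  func := inducedFunctor f ⋙ Arrow.rightFunc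
  map_W _ h := h.2
  map_C _ h := h.2
  map_F _ h := h.2

/-- The model diagram `J` is obtained from `I` by freely factoring `w`. -/
structure IsFreeFactorization (φ : MDHom MI MJ) {a b : I} (w : a ⟶ b) {m : J}
    (w₁ : φ.func.obj a ⟶ m) (w₂ : m ⟶ φ.func.obj b) : Prop where
  left_W : MJ.W w₁
  left_C : MJ.C w₁
  right_W : MJ.W w₂
  right_F : MJ.F w₂
  fac : w₁ ≫ w₂ = φ.func.map w
  existsUnique : ∀ (E : Type u) [Category.{v} E] (ME : ModelDiag E) (X : MDHom MI ME)
      (mE : E) (u₁ : X.func.obj a ⟶ mE) (u₂ : mE ⟶ X.func.obj b),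
      ME.W u₁ → ME.C u₁ → ME.W u₂ → ME.F u₂ → u₁ ≫ u₂ = X.func.map w →
      ∃! Y : MDHom MJ ME, φ.comp Y = X ∧ Y.func.obj m = mE ∧
        HEq (Y.func.map w₁) u₁ ∧ HEq (Y.func.map w₂) u₂

lemma natTrans_app_eq_eqToHom {F G : J ⥤ E} (η : F ⟶ G) {p q : J} (e : p = q)
    {h : F.obj q = G.obj q} (hη : η.app q = eqToHom h) :
    η.app p = eqToHom (by rw [e, h]) := by
  subst e
  exact hη

namespace IsFreeFactorization

section

variable {φ : MDHom MI MJ} {a b : I} {w : a ⟶ b} {m : J} {w₁ : φ.func.obj a ⟶ m}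
  {w₂ : m ⟶ φ.func.obj b}

lemma hom_ext (h : IsFreeFactorization φ w w₁ w₂) {Y Y' : MDHom MJ ME} (hφ : φ.comp Y = φ.comp Y')
    (hm : Y.func.obj m = Y'.func.obj m) (h₁ : HEq (Y.func.map w₁) (Y'.func.map w₁))
    (h₂ : HEq (Y.func.map w₂) (Y'.func.map w₂)) : Y = Y' :=
  (h.existsUnique E ME (φ.comp Y') (Y'.func.obj m) (Y'.func.map w₁) (Y'.func.map w₂)
    (Y'.map_W _ h.left_W) (Y'.map_C _ h.left_C) (Y'.map_W _ h.right_W) (Y'.map_F _ h.right_F)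
    ((Y'.func.map_comp _ _).symm.trans (congrArg Y'.func.map h.fac))).unique ⟨hφ, hm, h₁, h₂⟩
    ⟨rfl, rfl, .rfl, .rfl⟩

lemma comp_hom_ext (h : IsFreeFactorization φ w w₁ w₂) {K : Type u} [Category.{v} K]
    {MK : ModelDiag K} {X : MDHom MI MK} {mK : K} {u₁ : X.func.obj a ⟶ mK}
    {u₂ : mK ⟶ X.func.obj b} {Z : MDHom MJ MK} (hφ : φ.comp Z = X) (hm : Z.func.obj m = mK)
    (h₁ : HEq (Z.func.map w₁) u₁) (h₂ : HEq (Z.func.map w₂) u₂) (V : MDHom MK ME)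
    {Y : MDHom MJ ME} (hY : φ.comp Y = X.comp V) (hm' : Y.func.obj m = V.func.obj mK)
    (h₁' : HEq (Y.func.map w₁) (V.func.map u₁)) (h₂' : HEq (Y.func.map w₂) (V.func.map u₂)) :
    Z.comp V = Y := by
  subst hφ hm
  obtain rfl := eq_of_heq h₁
  obtain rfl := eq_of_heq h₂
  exact h.hom_ext hY.symm hm'.symm h₁'.symm h₂'.symm

lemma obj_cases (h : IsFreeFactorization φ w w₁ w₂) (j : J) :
    (∃ i, φ.func.obj i = j) ∨ j = m := by
  let p (j : J) : Prop := (∃ i, φ.func.obj i = j) ∨ j = m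
  let f : Subtype p → J := Subtype.val
  let X : MDHom MI (MJ.induced f) :=
    { func :=
        { obj i := (⟨φ.func.obj i, Or.inl ⟨i, rfl⟩⟩ : Subtype p)
          map g := ⟨φ.func.map g⟩
          map_id i := InducedCategory.hom_ext (φ.func.map_id i)
          map_comp g g' := InducedCategory.hom_ext (φ.func.map_comp g g') }
      map_W := φ.map_W
      map_C := φ.map_C
      map_F := φ.map_F }
  obtain ⟨Z, ⟨hφ, hm, h₁, h₂⟩, -⟩ := h.existsUnique _ (MJ.induced f) X ⟨m, Or.inr rfl⟩ ⟨w₁⟩ ⟨w₂⟩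
    h.left_W h.left_C h.right_W h.right_F (InducedCategory.hom_ext h.fac)
  have key : Z.comp (MJ.inducedHom f) = MDHom.id MJ :=
    h.comp_hom_ext hφ hm h₁ h₂ _ rfl rfl .rfl .rfl
  have hj : (Z.func.obj j : Subtype p).1 = j :=
    congrArg (fun Y : MDHom MJ MJ ↦ Y.func.obj j) key
  exact hj ▸ (Z.func.obj j : Subtype p).2

lemma exists_natTrans (h : IsFreeFactorization φ w w₁ w₂) {Y Y' : MDHom MJ ME}
    (η : φ.func ⋙ Y.func ⟶ φ.func ⋙ Y'.func) (μ : Y.func.obj m ⟶ Y'.func.obj m)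
    (hμ₁ : Y.func.map w₁ ≫ μ = η.app a ≫ Y'.func.map w₁)
    (hμ₂ : μ ≫ Y'.func.map w₂ = Y.func.map w₂ ≫ η.app b) :
    ∃ θ : Y.func ⟶ Y'.func, CategoryTheory.Functor.whiskerLeft φ.func θ = η ∧ θ.app m = μ := by
  let f : Option I → Arrow E
    | some i => Arrow.mk (η.app i)
    | none => Arrow.mk μ
  let X : MDHom MI (ME.arrow.induced f) :=
    { func :=
        { obj i := some i
          map g := ⟨Arrow.homMk (Y.func.map (φ.func.map g)) (Y'.func.map (φ.func.map g))
            (η.naturality g)⟩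
          map_id i := InducedCategory.hom_ext (Arrow.hom_ext _ _
            ((φ.func ⋙ Y.func).map_id i) ((φ.func ⋙ Y'.func).map_id i))
          map_comp g g' := InducedCategory.hom_ext (Arrow.hom_ext _ _
            ((φ.func ⋙ Y.func).map_comp g g') ((φ.func ⋙ Y'.func).map_comp g g')) }
      map_W g hg := ⟨Y.map_W _ (φ.map_W _ hg), Y'.map_W _ (φ.map_W _ hg)⟩
      map_C g hg := ⟨Y.map_C _ (φ.map_C _ hg), Y'.map_C _ (φ.map_C _ hg)⟩
      map_F g hg := ⟨Y.map_F _ (φ.map_F _ hg), Y'.map_F _ (φ.map_F _ hg)⟩ }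
  have hfac (V : MDHom MJ ME) : V.func.map w₁ ≫ V.func.map w₂ = V.func.map (φ.func.map w) :=
    (V.func.map_comp _ _).symm.trans (congrArg V.func.map h.fac)
  obtain ⟨Z, ⟨hφ, hm, h₁, h₂⟩, -⟩ := h.existsUnique _ (ME.arrow.induced f) X none
    ⟨Arrow.homMk (Y.func.map w₁) (Y'.func.map w₁) hμ₁⟩
    ⟨Arrow.homMk (Y.func.map w₂) (Y'.func.map w₂) hμ₂.symm⟩
    ⟨Y.map_W _ h.left_W, Y'.map_W _ h.left_W⟩ ⟨Y.map_C _ h.left_C, Y'.map_C _ h.left_C⟩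
    ⟨Y.map_W _ h.right_W, Y'.map_W _ h.right_W⟩ ⟨Y.map_F _ h.right_F, Y'.map_F _ h.right_F⟩
    (InducedCategory.hom_ext (Arrow.hom_ext _ _ (hfac Y) (hfac Y')))
  have hY : Z.comp (ME.arrowSource f) = Y := h.comp_hom_ext hφ hm h₁ h₂ _ rfl rfl .rfl .rfl
  have hY' : Z.comp (ME.arrowTarget f) = Y' := h.comp_hom_ext hφ hm h₁ h₂ _ rfl rfl .rfl .rfl
  let θ : (Z.comp (ME.arrowSource f)).func ⟶ (Z.comp (ME.arrowTarget f)).func :=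
    CategoryTheory.Functor.whiskerLeft Z.func
      (CategoryTheory.Functor.whiskerLeft (inducedFunctor f) Arrow.leftToRight)
  have key : ∀ {V V' : MDHom MJ ME} (e : Z.comp (ME.arrowSource f) = V)
      (e' : Z.comp (ME.arrowTarget f) = V'), ∃ θ' : V.func ⟶ V'.func, ∀ j,
        HEq (θ'.app j) (f (Z.func.obj j)).hom := by
    rintro _ _ rfl rfl
    exact ⟨θ, fun _ ↦ .rfl⟩
  obtain ⟨θ', hθ'⟩ := key hY hY'
  refine ⟨θ', NatTrans.ext (funext fun i ↦ eq_of_heq ((hθ' (φ.func.obj i)).trans ?_)),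
    eq_of_heq ((hθ' m).trans ?_)⟩
  · have : Z.func.obj (φ.func.obj i) = some i :=
      congrArg (fun V : MDHom MI (ME.arrow.induced f) ↦ V.func.obj i) hφ
    rw [this]
    rfl
  · rw [hm]
    rfl

end

variable {sI tI : I} {sJ tJ : J} {φ : PtdMDHom MI sI tI MJ sJ tJ} {a b : I} {w : a ⟶ b} {m : J}
  {w₁ : φ.func.obj a ⟶ m} {w₂ : m ⟶ φ.func.obj b}

/-- The restriction of a diagram on a free factorization, together with the factorization. -/
def restrictFactorization (h : IsFreeFactorization φ.toMDHom w w₁ w₂) (ME : ModelDiag E)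
    (sE tE : E) : FunPt MJ sJ tJ ME sE tE ⥤
      (WeakFactorization.isFib MI sI tI ME sE tE w).FullSubcategory where
  obj Y := ⟨
    { diag := (restrict φ ME sE tE).obj Y
      mid := Y.func.obj m
      left := Y.func.map w₁
      right := Y.func.map w₂
      left_W := Y.map_W _ h.left_W
      left_C := Y.map_C _ h.left_C
      right_W := Y.map_W _ h.right_W
      fac := (Y.func.map_comp _ _).symm.trans (congrArg Y.func.map h.fac) }, Y.map_F _ h.right_F⟩
  map η := ⟨
    { diag := (restrict φ ME sE tE).map η
      mid := η.1.app m
      left_mid := η.1.naturality w₁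
      mid_right := (η.1.naturality w₂).symm }⟩

instance (h : IsFreeFactorization φ.toMDHom w w₁ w₂) (sE tE : E) :
    (h.restrictFactorization ME sE tE).Faithful where
  map_injective {Y Y'} η η' e := by
    refine Subtype.ext (NatTrans.ext (funext fun j ↦ ?_))
    obtain ⟨i, rfl⟩ | rfl := h.obj_cases j
    · exact congrArg (fun g ↦ g.hom.diag.1.app i) e
    · exact congrArg (fun g ↦ g.hom.mid) e

instance (h : IsFreeFactorization φ.toMDHom w w₁ w₂) (sE tE : E) :
    (h.restrictFactorization ME sE tE).Full where
  map_surjective {Y Y'} g := by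
    have hμ := WeakFactorization.Hom.mid_W g.hom
    obtain ⟨⟨⟨η, hW, hs, ht⟩, μ, h₁, h₂⟩⟩ := g
    obtain ⟨θ, hθ, rfl⟩ := h.exists_natTrans (Y := Y.toMDHom) (Y' := Y'.toMDHom) η μ h₁ h₂
    subst hθ
    refine ⟨⟨θ, fun j ↦ ?_, ?_, ?_⟩, rfl⟩
    · obtain ⟨i, rfl⟩ | rfl := h.obj_cases j
      · exact hW i
      · exact hμ
    · exact natTrans_app_eq_eqToHom θ φ.hs.symm hs
    · exact natTrans_app_eq_eqToHom θ φ.ht.symm ht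

instance (h : IsFreeFactorization φ.toMDHom w w₁ w₂) (sE tE : E) :
    (h.restrictFactorization ME sE tE).EssSurj where
  mem_essImage S := by
    obtain ⟨⟨⟨X, hs, ht⟩, mE, u₁, u₂, h₁W, h₁C, h₂W, hfac⟩, hF⟩ := S
    obtain ⟨Y, ⟨rfl, rfl, h₁, h₂⟩, -⟩ := h.existsUnique E ME X mE u₁ u₂ h₁W h₁C h₂W hF hfac
    obtain rfl := eq_of_heq h₁
    obtain rfl := eq_of_heq h₂
    exact ⟨⟨Y, (congrArg Y.func.obj φ.hs.symm).trans hs, (congrArg Y.func.obj φ.ht.symm).trans ht⟩,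
      ⟨Iso.refl _⟩⟩

instance (h : IsFreeFactorization φ.toMDHom w w₁ w₂) (sE tE : E) :
    (h.restrictFactorization ME sE tE).IsEquivalence where

/-- Restriction along a free factorization is a weak homotopy equivalence if weak equivalences
between diagrams of direct shape can be factored. -/
lemma isWeakHomotopyEquiv_restrict (h : IsFreeFactorization φ.toMDHom w w₁ w₂) (hw : MI.W w)
    (ME : ModelDiag E)
    (H : ∀ {T : Type (max u v)} [Category.{max u v} T] (_ : DirectDeg T) {L N : T ⥤ E} (α : L ⟶ N),
      (∀ {s t : T} (f : s ⟶ t), ME.W (L.map f)) → (∀ s, ME.W (α.app s)) →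
      ∃ (R : T ⥤ E) (m : L ⟶ R) (p : R ⟶ N), m ≫ p = α ∧
        ∀ s, ME.W (m.app s) ∧ ME.C (m.app s) ∧ ME.F (p.app s)) (sE tE : E) :
    IsWeakHomotopyEquiv (nerveMap (restrict φ ME sE tE)) :=
  ((isWeakHomotopyEquiv_of_isEquivalence (h.restrictFactorization ME sE tE)).comp
    (WeakFactorization.isWeakHomotopyEquiv_ι H)).comp
    (WeakFactorization.isWeakHomotopyEquiv_forget hw)

end IsFreeFactorization

end FreeFactorizations

/-- let `F : C ⇄ D : G` be a Quillen adjunction and let `x, y` be any two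
objects of the collage `(C^c+D^f)`, regarded as a doubly-pointed model diagram.  Let `I`
be a doubly-pointed model diagram, `w : a → b` a weak equivalence of `I`, and `J` the
doubly-pointed model diagram obtained from `I` by freely factoring `w` as an acyclic
cofibration followed by an acyclic fibration (pushout of model diagrams, expressed by its
universal property `hUP`).  Then restriction along the canonical morphism `I → J` induces
a weak homotopy equivalence `N(Fun_{**}(J,(C^c+D^f))^W) → N(Fun_{**}(I,(C^c+D^f))^W)`. -/
theorem statement6
    {C : Type u} {D : Type u} [Category.{v} C] [Category.{v} D]
    [HasFiniteLimits C] [HasFiniteColimits C] [HasFiniteLimits D] [HasFiniteColimits D]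
    {MC : ModelStructure C} {MD : ModelStructure D} (Q : QuillenAdjunction MC MD)
    (x y : Collage Q.G (Cofibrant MC) (Fibrant MD))
    {I : Type u} [Category.{v} I] (MI : ModelDiag I) (sI tI : I)
    {a b : I} (w : a ⟶ b) (hw : MI.W w)
    {J : Type u} [Category.{v} J] (MJ : ModelDiag J) (sJ tJ : J)
    (φ : PtdMDHom MI sI tI MJ sJ tJ)
    (m : J) (w₁ : φ.func.obj a ⟶ m) (w₂ : m ⟶ φ.func.obj b)
    (hw₁W : MJ.W w₁) (hw₁C : MJ.C w₁) (hw₂W : MJ.W w₂) (hw₂F : MJ.F w₂)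
    (hfac : w₁ ≫ w₂ = φ.func.map w)
    (hUP : ∀ (E : Type u) [Category.{v} E] (ME : ModelDiag E) (X : MDHom MI ME)
      (mE : E) (u₁ : X.func.obj a ⟶ mE) (u₂ : mE ⟶ X.func.obj b),
      ME.W u₁ → ME.C u₁ → ME.W u₂ → ME.F u₂ → u₁ ≫ u₂ = X.func.map w →
      ∃! Y : MDHom MJ ME, φ.toMDHom.comp Y = X ∧ Y.func.obj m = mE ∧
        HEq (Y.func.map w₁) u₁ ∧ HEq (Y.func.map w₂) u₂) :
    IsWeakHomotopyEquiv (nerveMap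
      (restrict φ (collageDiag Q (Cofibrant MC) (Fibrant MD)) x y)) :=
  IsFreeFactorization.isWeakHomotopyEquiv_restrict ⟨hw₁W, hw₁C, hw₂W, hw₂F, hfac, hUP⟩ hw _
    (fun δ ↦ δ.exists_collage_factorization Q) x y

end Paper
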